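/- arXiv:2408.01277 — 12 statements merged into one kernel-verified Lean document; each statement's English description precedes it below -/
import Mathlib

section
/- For every abelian group G: if G is Hopfian then G is relatively Hopfian; if G is relatively Hopfian then G is weakly Hopfian; and if G is weakly Hopfian then G is directly finite. -/
open Function

universe u

section Defs

variable (G : Type u) [AddCommGroup G]

/-- An abelian group is *Hopfian* if every surjective endomorphism is injective. -/
def Hopfian : Prop := ∀ φ : G →+ G, Surjective φ → Injective φ

/-- An abelian group `G` is *relatively Hopfian* if for every abelian group `A`,
every surjective homomorphism `G → G ⊕ A` forces `A = 0`. -/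
def RelativelyHopfian : Prop :=
  ∀ (A : Type u) [AddCommGroup A], ∀ φ : G →+ G × A, Surjective φ → Subsingleton A

/-- An abelian group `G` is *directly finite* if `G ≅ G ⊕ A` implies `A = 0`. -/
def DirectlyFinite : Prop :=
  ∀ (A : Type u) [AddCommGroup A], (G ≃+ G × A) → Subsingleton A

/-- The multiplication-by-`n` endomorphism of `G`. -/
def nsmulHom (n : ℕ) : G →+ G where
  toFun x := n • x
  map_zero' := smul_zero n
  map_add' := smul_add n

/-- The subgroup `nG` of `G`. -/
def smulSub (n : ℕ) : AddSubgroup G := (nsmulHom G n).range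

/-- The subgroup `G[n] = {x : G | n • x = 0}`. -/
def torsionSub (n : ℕ) : AddSubgroup G := (nsmulHom G n).ker

/-- A subgroup `H ≤ G` is *pure* if `H ∩ nG = nH` for every positive integer `n`. -/
def IsPureSubgroup {G : Type u} [AddCommGroup G] (H : AddSubgroup G) : Prop :=
  ∀ n : ℕ, 0 < n → ∀ x ∈ H, (∃ g : G, n • g = x) → ∃ y ∈ H, n • y = x

/-- An abelian group `G` is *weakly Hopfian* if every surjective endomorphism of `G`
with pure kernel is injective. -/
def WeaklyHopfian : Prop :=
  ∀ φ : G →+ G, Surjective φ → IsPureSubgroup φ.ker → Injective φ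

/-- `G` is an (abelian) `p`-group: every element has order a power of `p`. -/
def IsPAddGroup (p : ℕ) : Prop := ∀ x : G, ∃ n : ℕ, p ^ n • x = 0

/-- The subgroup `p^ω G = ⋂ₙ p^n G`. -/
def pOmega (p : ℕ) : AddSubgroup G := ⨅ n : ℕ, smulSub G (p ^ n)

/-- A subgroup is *bounded* if it is annihilated by some positive integer. -/
def IsBoundedSubgroup {G : Type u} [AddCommGroup G] (H : AddSubgroup G) : Prop :=
  ∃ n : ℕ, 0 < n ∧ ∀ x ∈ H, n • x = 0

/-- A subgroup is *divisible* (as a group in its own right). -/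
def IsDivisibleSubgroup {G : Type u} [AddCommGroup G] (H : AddSubgroup G) : Prop :=
  ∀ n : ℕ, 0 < n → ∀ x ∈ H, ∃ y ∈ H, n • y = x

/-- A *divisible* abelian group. -/
def DivisibleGroup : Prop := ∀ n : ℕ, 0 < n → ∀ x : G, ∃ y : G, n • y = x

/-- A *reduced* abelian group: its only divisible subgroup is trivial. -/
def ReducedGroup : Prop := ∀ H : AddSubgroup G, IsDivisibleSubgroup H → H = ⊥

/-- A *torsion* abelian group: every element has finite order. -/
def TorsionGroup : Prop := ∀ x : G, ∃ n : ℕ, 0 < n ∧ n • x = 0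

/-- A *torsion-free* abelian group. -/
def TorsionFreeGroup : Prop := ∀ x : G, ∀ n : ℕ, 0 < n → n • x = 0 → x = 0

/-- The `p`-primary component of `G`: elements of order a power of `p`. -/
def pComponent (p : ℕ) : AddSubgroup G where
  carrier := {x : G | ∃ n : ℕ, p ^ n • x = 0}
  zero_mem' := ⟨0, smul_zero _⟩
  add_mem' := by
    rintro a b ⟨m, hm⟩ ⟨n, hn⟩
    refine ⟨m + n, ?_⟩
    have h1 : p ^ (m + n) • a = 0 := by
      rw [pow_add, mul_comm, mul_smul, hm, smul_zero]
    have h2 : p ^ (m + n) • b = 0 := by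
      rw [pow_add, mul_smul, hn, smul_zero]
    rw [smul_add, h1, h2, add_zero]
  neg_mem' := by
    rintro a ⟨n, hn⟩
    exact ⟨n, by rw [smul_neg, hn, neg_zero]⟩

/-- The subgroup `(p^k G)[p]` of `G`. -/
def ulmSub (p k : ℕ) : AddSubgroup G := smulSub G (p ^ k) ⊓ torsionSub G p

/-- The Ulm quotient `(p^k G)[p] / (p^{k+1} G)[p]`. -/
abbrev UlmQuot (p k : ℕ) :=
  ↥(ulmSub G p k) ⧸ ((ulmSub G p (k + 1)).addSubgroupOf (ulmSub G p k))

theorem UlmQuot_nsmul (p k : ℕ) (x : UlmQuot G p k) : p • x = 0 := by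
  induction x using QuotientAddGroup.induction_on with
  | _ a =>
    have ha : p • a = (0 : ↥(ulmSub G p k)) := by
      ext
      exact a.2.2
    rw [← QuotientAddGroup.mk_nsmul, ha, QuotientAddGroup.mk_zero]

theorem torsionSub_nsmul (p : ℕ) (x : ↥(torsionSub G p)) : p • x = 0 := by
  ext
  exact x.2

/-- The `k`-th Ulm invariant of `G` at `p`: the dimension of
`(p^k G)[p] / (p^{k+1} G)[p]` over `ℤ/pℤ`, as a cardinal. -/
noncomputable def UlmInvariant (p k : ℕ) : Cardinal :=
  letI : Module (ZMod p) (UlmQuot G p k) := AddCommGroup.zmodModule (UlmQuot_nsmul G p k)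
  Module.rank (ZMod p) (UlmQuot G p k)

/-- `G` is `p`-*semi-standard* if all the finite Ulm invariants are finite. -/
def PSemiStandard (p : ℕ) : Prop := ∀ n : ℕ, UlmInvariant G p n < Cardinal.aleph0

/-- The `p`-rank of `G`: the dimension of `G[p]` over `ℤ/pℤ`, as a cardinal. -/
noncomputable def pRank (p : ℕ) : Cardinal :=
  letI : Module (ZMod p) ↥(torsionSub G p) := AddCommGroup.zmodModule (torsionSub_nsmul G p)
  Module.rank (ZMod p) ↥(torsionSub G p)

/-- The (torsion-free) rank of `G`: the dimension of `ℚ ⊗ G` over `ℚ`. -/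
noncomputable def rationalRank : Cardinal :=
  Module.rank ℚ (TensorProduct ℤ ℚ G)

/-- The maximal divisible subgroup of `G`. -/
def maxDivisible : AddSubgroup G := sSup {H : AddSubgroup G | IsDivisibleSubgroup H}

/-- The Prüfer `p`-group `ℤ(p^∞)`, realized as the `p`-primary component of `ℚ/ℤ`. -/
abbrev PruferGroup (p : ℕ) :=
  ↥(pComponent (ℚ ⧸ AddSubgroup.zmultiples (1 : ℚ)) p)

end Defs

/-- Linear functionals separate points. -/
theorem exists_functional {F : Type} {V : Type u} [Field F] [AddCommGroup V] [Module F V]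
    (v : V) (hv : v ≠ 0) : ∃ f : V →+ F, f v ≠ 0 := by
  by_contra! h
  exact hv ((Module.forall_dual_apply_eq_zero_iff F v).1 fun f => h (LinearMap.toAddMonoidHom f))

/-- Characters of exponent `p` groups separate points. -/
theorem exists_zmod_character {V : Type u} [AddCommGroup V] (p : ℕ) [Fact p.Prime]
    (hV : ∀ v : V, p • v = 0) (v : V) (hv : v ≠ 0) : ∃ f : V →+ ZMod p, f v ≠ 0 :=
  @exists_functional (ZMod p) V _ _ (AddCommGroup.zmodModule hV) v hv

/-- A nonzero pure subgroup `K` of `G` surjects onto a nonzero group through a map defined on `G`. -/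
theorem exists_hom_of_pure {G : Type u} [AddCommGroup G] (K : AddSubgroup G)
    (hK : IsPureSubgroup K) (k₀ : G) (hk₀ : k₀ ∈ K) (hne : k₀ ≠ 0) :
    ∃ (A : Type u) (_ : AddCommGroup A) (ψ : G →+ A),
      Nontrivial A ∧ ∀ a : A, ∃ k ∈ K, ψ k = a := by
  by_cases hd : ∀ p : ℕ, p.Prime → ∀ x ∈ K, ∃ y ∈ K, p • y = x
  · -- divisible case
    have hdiv : ∀ n : ℕ, n ≠ 0 → ∀ x ∈ K, ∃ y ∈ K, n • y = x := by
      intro n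
      induction n using Nat.recOnMul with
      | zero => intro h; exact absurd rfl h
      | one => intro _ x hx; exact ⟨x, hx, one_smul _ x⟩
      | prime p hp => intro _; exact hd p hp
      | mul a b iha ihb =>
        intro hab x hx
        obtain ⟨y, hy, rfl⟩ := iha (left_ne_zero_of_mul hab) x hx
        obtain ⟨z, hz, rfl⟩ := ihb (right_ne_zero_of_mul hab) y hy
        exact ⟨z, hz, mul_smul a b z⟩
    let : DivisibleBy K ℕ := divisibleByOfSMulRightSurj K ℕ (by
      intro n hn x
      obtain ⟨y, hy, hyx⟩ := hdiv n hn x x.2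
      exact ⟨⟨y, hy⟩, Subtype.ext hyx⟩)
    let : DivisibleBy K ℤ := AddGroup.divisibleByIntOfDivisibleByNat K
    obtain ⟨ψ, hψ⟩ := (Module.Baer.of_divisible K).extension_property_addMonoidHom K.subtype
      Subtype.val_injective (AddMonoidHom.id K)
    refine ⟨K, inferInstance, ψ, ⟨⟨⟨k₀, hk₀⟩, 0, ?_⟩⟩, ?_⟩
    · intro h; exact hne (congrArg Subtype.val h)
    · intro a; exact ⟨a, a.2, DFunLike.congr_fun hψ a⟩
  · push Not at hd
    obtain ⟨p, hp, x, hx, hxp⟩ := hd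
    have : Fact p.Prime := ⟨hp⟩
    have hx0 : (QuotientAddGroup.mk x : G ⧸ smulSub G p) ≠ 0 := by
      intro h
      obtain ⟨g, hg⟩ := (QuotientAddGroup.eq_zero_iff x).1 h
      obtain ⟨y, hy, hyx⟩ := hK p hp.pos x hx ⟨g, hg⟩
      exact hxp y hy hyx
    obtain ⟨f, hf⟩ := exists_zmod_character (V := G ⧸ smulSub G p) p (by
      intro v
      induction v using QuotientAddGroup.induction_on with
      | _ y =>
        rw [← QuotientAddGroup.mk_nsmul]
        exact (QuotientAddGroup.eq_zero_iff _).2 ⟨y, rfl⟩) _ hx0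
    refine ⟨ULift.{u} (ZMod p), inferInstance,
      (AddEquiv.ulift.symm.toAddMonoidHom.comp f).comp
        (QuotientAddGroup.mk' (smulSub G p)), inferInstance, ?_⟩
    rintro ⟨a⟩
    refine ⟨(a / f (QuotientAddGroup.mk x)).val • x, K.nsmul_mem hx _, ?_⟩
    rw [map_nsmul]
    apply ULift.ext
    change (a / f (QuotientAddGroup.mk x)).val • f (QuotientAddGroup.mk x) = a
    rw [nsmul_eq_mul, ZMod.natCast_zmod_val, div_mul_cancel₀ _ hf]

/-- For every abelian group `G`: Hopfian → relatively Hopfian →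
weakly Hopfian → directly finite. -/
theorem hopfian_chain (G : Type u) [AddCommGroup G] :
    (Hopfian G → RelativelyHopfian G) ∧ (RelativelyHopfian G → WeaklyHopfian G) ∧
      (WeaklyHopfian G → DirectlyFinite G) := by
  refine ⟨?_, ?_, ?_⟩
  · intro h A _ φ hφ
    have hinj := h ((AddMonoidHom.fst G A).comp φ) (Prod.fst_surjective.comp hφ)
    refine subsingleton_of_forall_eq 0 fun a => ?_
    obtain ⟨g, hg⟩ := hφ (0, a)
    have hg0 : g = 0 := hinj (by simp [hg])
    subst hg0
    simpa using (congrArg Prod.snd hg).symm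
  · intro h φ hφ hpure
    rw [injective_iff_map_eq_zero]
    intro k hk
    by_contra hne
    obtain ⟨A, _, ψ, hA, hψ⟩ := exists_hom_of_pure φ.ker hpure k hk hne
    refine not_subsingleton A (h A (φ.prod ψ) ?_)
    rintro ⟨g, a⟩
    obtain ⟨x, rfl⟩ := hφ g
    obtain ⟨y, hy, hya⟩ := hψ (a - ψ x)
    refine ⟨x + y, ?_⟩
    have hy' : φ y = 0 := hy
    simp [hy', hya]
  · intro h A _ e
    have hinj := h ((AddMonoidHom.fst G A).comp e.toAddMonoidHom)
      (Prod.fst_surjective.comp e.surjective) (by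
        rintro n - x hx ⟨g, rfl⟩
        have hx' : (e (n • g)).1 = 0 := hx
        have hn : n • (e g).1 = 0 := by simpa using hx'
        refine ⟨e.symm (0, (e g).2), (by change (e (e.symm (0, (e g).2))).1 = 0; simp), ?_⟩
        apply e.injective
        ext <;> simp [hn])
    refine subsingleton_of_forall_eq 0 fun a => ?_
    have h0 : e.symm (0, a) = 0 := hinj (by simp)
    have h1 := congrArg e h0
    simpa using congrArg Prod.snd h1
end

section
/- Each of the four classes of Hopfian, relatively Hopfian, weakly Hopfian, and directly finite abelian groups is closed under direct summands: if G = H ⊕ K and G belongs to one of these classes, then K (and likewise H) belongs to the same class. -/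
open Function

universe u

/-- Extend an endomorphism of `H` to `G ≅ H × K` by the identity on `K`. -/
def extendEnd {G H K : Type u} [AddCommGroup G] [AddCommGroup H] [AddCommGroup K]
    (e : G ≃+ H × K) (φ : H →+ H) : G →+ G :=
  e.symm.toAddMonoidHom.comp ((φ.prodMap (AddMonoidHom.id K)).comp e.toAddMonoidHom)

theorem extendEnd_apply {G H K : Type u} [AddCommGroup G] [AddCommGroup H] [AddCommGroup K]
    (e : G ≃+ H × K) (φ : H →+ H) (g : G) :
    extendEnd e φ g = e.symm (φ (e g).1, (e g).2) := rfl

theorem extendEnd_surjective {G H K : Type u} [AddCommGroup G] [AddCommGroup H] [AddCommGroup K]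
    (e : G ≃+ H × K) (φ : H →+ H) (hφ : Surjective φ) : Surjective (extendEnd e φ) := by
  intro g
  obtain ⟨x, hx⟩ := hφ (e g).1
  refine ⟨e.symm (x, (e g).2), ?_⟩
  simp [extendEnd_apply, hx]

theorem injective_of_extendEnd {G H K : Type u} [AddCommGroup G] [AddCommGroup H]
    [AddCommGroup K] (e : G ≃+ H × K) (φ : H →+ H) (h : Injective (extendEnd e φ)) :
    Injective φ := by
  intro a b hab
  have h1 : e.symm (a, (0 : K)) = e.symm (b, 0) := by
    apply h
    simp [extendEnd_apply, hab]
  exact congrArg Prod.fst (e.symm.injective h1)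

theorem extendEnd_pure {G H K : Type u} [AddCommGroup G] [AddCommGroup H] [AddCommGroup K]
    (e : G ≃+ H × K) (φ : H →+ H) (hp : IsPureSubgroup φ.ker) :
    IsPureSubgroup (extendEnd e φ).ker := by
  rintro n hn x hx ⟨g, hg⟩
  rw [AddMonoidHom.mem_ker, extendEnd_apply, EmbeddingLike.map_eq_zero_iff,
    Prod.mk_eq_zero] at hx
  obtain ⟨y, hy, hyx⟩ := hp n hn (e x).1 hx.1 ⟨(e g).1, by rw [← hg]; simp⟩
  refine ⟨e.symm (y, 0), ?_, ?_⟩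
  · rw [AddMonoidHom.mem_ker] at hy ⊢
    rw [extendEnd_apply, EmbeddingLike.map_eq_zero_iff]
    simp [hy]
  · apply e.injective
    rw [map_nsmul, AddEquiv.apply_symm_apply]
    ext
    · exact hyx
    · simp [hx.2]

/-- The rearrangement `(H × A) × K ≃ G × A`. -/
def rearr {G H K : Type u} [AddCommGroup G] [AddCommGroup H] [AddCommGroup K]
    (e : G ≃+ H × K) (A : Type u) [AddCommGroup A] : (H × A) × K ≃+ G × A where
  toFun x := (e.symm (x.1.1, x.2), x.1.2)
  invFun y := (((e y.1).1, y.2), (e y.1).2)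
  left_inv x := by simp
  right_inv y := by simp
  map_add' x y := by
    ext
    · simp [← map_add]
    · simp

theorem summand_left {G H K : Type u} [AddCommGroup G]
    [AddCommGroup H] [AddCommGroup K] (e : G ≃+ H × K) :
    (Hopfian G → Hopfian H) ∧ (RelativelyHopfian G → RelativelyHopfian H) ∧
    (WeaklyHopfian G → WeaklyHopfian H) ∧ (DirectlyFinite G → DirectlyFinite H) := by
  refine ⟨fun h φ hφ => ?_, fun h A _ φ hφ => ?_, fun h φ hφ hp => ?_, fun h A _ φ => ?_⟩
  · exact injective_of_extendEnd e φ (h _ (extendEnd_surjective e φ hφ))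
  · refine h A ((rearr e A).toAddMonoidHom.comp
      ((φ.prodMap (AddMonoidHom.id K)).comp e.toAddMonoidHom)) ?_
    exact (rearr e A).surjective.comp
      ((hφ.prodMap (surjective_id (α := K))).comp e.surjective)
  · exact injective_of_extendEnd e φ
      (h _ (extendEnd_surjective e φ hφ) (extendEnd_pure e φ hp))
  · exact h A ((e.trans (φ.prodCongr (AddEquiv.refl K))).trans (rearr e A))

/-- The four classes are closed under direct summands. -/
theorem classes_closed_under_direct_summands (G H K : Type u) [AddCommGroup G]
    [AddCommGroup H] [AddCommGroup K] (e : G ≃+ H × K) :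
    (Hopfian G → Hopfian H ∧ Hopfian K) ∧
    (RelativelyHopfian G → RelativelyHopfian H ∧ RelativelyHopfian K) ∧
    (WeaklyHopfian G → WeaklyHopfian H ∧ WeaklyHopfian K) ∧
    (DirectlyFinite G → DirectlyFinite H ∧ DirectlyFinite K) := by
  obtain ⟨a, b, c, d⟩ := summand_left e
  obtain ⟨a', b', c', d'⟩ := summand_left (e.trans AddEquiv.prodComm)
  exact ⟨fun h => ⟨a h, a' h⟩, fun h => ⟨b h, b' h⟩, fun h => ⟨c h, c' h⟩,
    fun h => ⟨d h, d' h⟩⟩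
end

section
/- Let G be an abelian group, p a prime, and H a subgroup of G. If G/H ≅ G and some element h ∈ H has p-height 0 in G (i.e., h ∉ pG), then G is not relatively Hopfian. -/
open Function

universe u

/-- A nonzero vector is detected by a linear functional. -/
theorem exists_hom_field_ne_zero {K : Type} {V : Type u} [Field K] [AddCommGroup V] [Module K V]
    (v : V) (hv : v ≠ 0) : ∃ f : V →+ K, f v ≠ 0 := by
  by_contra! hcon
  exact hv ((Module.forall_dual_apply_eq_zero_iff K v).1
    fun f => hcon (LinearMap.toAddMonoidHom f))

/-- A nonzero element of an elementary abelian `p`-group is detected by a map to `ZMod p`. -/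
theorem exists_hom_zmod_ne_zero {V : Type u} [AddCommGroup V] (p : ℕ) [Fact p.Prime]
    (hV : ∀ x : V, p • x = 0) (v : V) (hv : v ≠ 0) : ∃ f : V →+ ZMod p, f v ≠ 0 :=
  @exists_hom_field_ne_zero (ZMod p) V _ _ (AddCommGroup.zmodModule hV) v hv

/-- If `G/H ≅ G` and some `h ∈ H` has `p`-height `0` in `G`
(i.e. `h ∉ pG`), then `G` is not relatively Hopfian. -/
theorem not_relativelyHopfian_of_min_height_zero (G : Type u) [AddCommGroup G]
    (p : ℕ) (hp : p.Prime) (H : AddSubgroup G) (hiso : Nonempty ((G ⧸ H) ≃+ G))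
    (hh : ∃ h ∈ H, h ∉ smulSub G p) : ¬ RelativelyHopfian G := by
  classical
  intro hG
  obtain ⟨e⟩ := hiso
  obtain ⟨h, hH, hnot⟩ := hh
  have : Fact p.Prime := ⟨hp⟩
  have hq : ∀ x : G ⧸ smulSub G p, p • x = 0 := by
    intro x
    induction x using QuotientAddGroup.induction_on with
    | _ a =>
      rw [← QuotientAddGroup.mk_nsmul, QuotientAddGroup.eq_zero_iff]
      exact ⟨a, rfl⟩
  have hne : (QuotientAddGroup.mk h : G ⧸ smulSub G p) ≠ 0 := by
    rw [Ne, QuotientAddGroup.eq_zero_iff]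
    exact hnot
  obtain ⟨f, hf⟩ := exists_hom_zmod_ne_zero p hq _ hne
  let π : G →+ G := e.toAddMonoidHom.comp (QuotientAddGroup.mk' H)
  let g : G →+ ZMod p := f.comp (QuotientAddGroup.mk' (smulSub G p))
  have hπ : π h = 0 := by
    have : (QuotientAddGroup.mk h : G ⧸ H) = 0 := (QuotientAddGroup.eq_zero_iff h).2 hH
    change e (QuotientAddGroup.mk h) = 0
    rw [this, map_zero]
  have hg : g h ≠ 0 := hf
  let φ : G →+ G × ULift.{u} (ZMod p) :=
    π.prod (AddEquiv.ulift.symm.toAddMonoidHom.comp g)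
  have hφ : Surjective φ := by
    rintro ⟨x, ⟨a⟩⟩
    obtain ⟨y, hy⟩ : ∃ y, π y = x := by
      obtain ⟨y, hy⟩ := QuotientAddGroup.mk_surjective (e.symm x)
      exact ⟨y, by change e (QuotientAddGroup.mk y) = x; rw [hy, e.apply_symm_apply]⟩
    refine ⟨y + ((a - g y) / g h).val • h, Prod.ext ?_ (ULift.ext _ _ ?_)⟩
    · change π _ = x
      rw [map_add, map_nsmul, hπ, smul_zero, add_zero, hy]
    · change g _ = a
      rw [map_add, map_nsmul, nsmul_eq_mul, ZMod.natCast_zmod_val, div_mul_cancel₀ _ hg]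
      abel
  have hs := hG (ULift.{u} (ZMod p)) φ hφ
  exact zero_ne_one (congrArg ULift.down (hs.elim ⟨(0 : ZMod p)⟩ ⟨1⟩))
end

section
/- An abelian group G is relatively Hopfian if and only if for every prime p there is no surjective homomorphism γ : G → G ⊕ Z, where Z is either the cyclic group ℤ/pℤ or the Prüfer p-group ℤ(p^∞). -/
open Function

universe u

theorem prufer_divisible (p : ℕ) (hp : p.Prime) (n : ℕ) (hn : n ≠ 0) (x : PruferGroup p) :
    ∃ y : PruferGroup p, n • y = x := by
  obtain ⟨x, k, hk⟩ := x
  obtain ⟨e, m, hm, rfl⟩ := Nat.exists_eq_pow_mul_and_not_dvd hn p hp.one_lt.ne'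
  have hy : ∃ y0 : ℚ ⧸ AddSubgroup.zmultiples (1 : ℚ), (p ^ e * m) • y0 = x := by
    induction x using QuotientAddGroup.induction_on with
    | _ q =>
      refine ⟨((q / (p ^ e * m : ℕ) : ℚ) : ℚ ⧸ AddSubgroup.zmultiples (1 : ℚ)), ?_⟩
      rw [← QuotientAddGroup.mk_nsmul, nsmul_eq_mul, mul_div_cancel₀]
      exact_mod_cast hn
  obtain ⟨y0, hy0⟩ := hy
  have hcop : IsCoprime (m : ℤ) ((p ^ k : ℕ) : ℤ) :=
    Nat.isCoprime_iff_coprime.2 (((hp.coprime_iff_not_dvd.2 hm).pow_left k).symm)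
  obtain ⟨u, v, huv⟩ := hcop
  have hkz : ((p ^ k : ℕ) : ℤ) • x = 0 := by rw [natCast_zsmul]; exact hk
  have hyz : ((p ^ e * m : ℕ) : ℤ) • y0 = x := by rw [natCast_zsmul]; exact hy0
  have hux : (u * m) • x = x := by
    have h1 : (u * m + v * ((p ^ k : ℕ) : ℤ)) • x = x := by rw [huv, one_smul]
    rwa [add_smul, mul_smul v, hkz, smul_zero, add_zero] at h1
  refine ⟨⟨(u * m) • y0, k + e, ?_⟩, ?_⟩
  · have : ((p ^ (k + e) : ℕ) : ℤ) • (u * (m : ℤ)) • y0 = 0 := by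
      have h2 : ((p ^ (k + e) : ℕ) : ℤ) * (u * (m : ℤ))
          = u * ((p ^ k : ℕ) : ℤ) * ((p ^ e * m : ℕ) : ℤ) := by
        push_cast; ring
      rw [smul_smul, h2, mul_smul, hyz, mul_smul, hkz, smul_zero]
    rwa [natCast_zsmul] at this
  · apply Subtype.ext
    change (p ^ e * m) • ((u * (m : ℤ)) • y0) = x
    rw [smul_comm, hy0, hux]

/-- The class of `1/p`. -/
noncomputable def pruferGen (p : ℕ) : PruferGroup p :=
  ⟨((1 / p : ℚ) : ℚ ⧸ AddSubgroup.zmultiples (1 : ℚ)), 1, by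
    rw [pow_one, ← QuotientAddGroup.mk_nsmul, nsmul_eq_mul, QuotientAddGroup.eq_zero_iff]
    rcases Nat.eq_zero_or_pos p with rfl | h
    · simp
    · rw [mul_one_div_cancel (by positivity)]
      exact AddSubgroup.mem_zmultiples _⟩

theorem prufer_p_torsion (p : ℕ) (hp : p.Prime) (x : PruferGroup p) (hx : p • x = 0) :
    ∃ k : ℤ, k • pruferGen p = x := by
  obtain ⟨x, hx'⟩ := x
  have hx2 : p • x = 0 := congrArg Subtype.val hx
  clear hx
  induction x using QuotientAddGroup.induction_on with
  | _ q =>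
    rw [← QuotientAddGroup.mk_nsmul, nsmul_eq_mul, QuotientAddGroup.eq_zero_iff] at hx2
    obtain ⟨k, hk⟩ := AddSubgroup.mem_zmultiples_iff.1 hx2
    refine ⟨k, Subtype.ext ?_⟩
    change k • ((1 / p : ℚ) : ℚ ⧸ AddSubgroup.zmultiples (1 : ℚ)) = _
    rw [← QuotientAddGroup.mk_zsmul]
    congr 1
    have : (p : ℚ) ≠ 0 := by exact_mod_cast hp.ne_zero
    simp only [zsmul_eq_mul, mul_one] at hk ⊢
    field_simp
    linarith

theorem pruferGen_smul (p : ℕ) (hp : p.Prime) : p • pruferGen p = 0 := by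
  apply Subtype.ext
  change p • ((1 / p : ℚ) : ℚ ⧸ AddSubgroup.zmultiples (1 : ℚ)) = 0
  have : (p : ℚ) ≠ 0 := by exact_mod_cast hp.ne_zero
  rw [← QuotientAddGroup.mk_nsmul, nsmul_eq_mul, QuotientAddGroup.eq_zero_iff,
    mul_one_div_cancel this]
  exact AddSubgroup.mem_zmultiples _

theorem pruferGen_ne_zero (p : ℕ) (hp : p.Prime) : pruferGen p ≠ 0 := by
  intro h
  have h : ((1 / p : ℚ) : ℚ ⧸ AddSubgroup.zmultiples (1 : ℚ)) = 0 := congrArg Subtype.val h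
  rw [QuotientAddGroup.eq_zero_iff] at h
  obtain ⟨k, hk⟩ := AddSubgroup.mem_zmultiples_iff.1 h
  have h0 : (p : ℚ) ≠ 0 := by exact_mod_cast hp.ne_zero
  simp only [zsmul_eq_mul, mul_one] at hk
  rw [eq_div_iff h0] at hk
  have hk' : k * (p : ℤ) = 1 := by exact_mod_cast hk
  have := Int.natCast_dvd_natCast.1 (show (p : ℤ) ∣ ((1 : ℕ) : ℤ) from ⟨k, by push_cast; linarith⟩)
  exact hp.one_lt.ne' (Nat.dvd_one.1 this)

theorem exists_surj_of_ne_zero (K : Type) [Field K] (V : Type u) [AddCommGroup V] [Module K V]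
    {b : V} (hb : b ≠ 0) : ∃ f : V →+ K, Surjective f := by
  obtain ⟨f, hf⟩ := Module.Projective.exists_dual_ne_zero K hb
  have hs : Surjective f := LinearMap.surjective (by rintro rfl; exact hf rfl)
  exact ⟨f.toAddMonoidHom, hs⟩

theorem exists_surj_zmod {A : Type u} [AddCommGroup A] (p : ℕ) (hp : p.Prime) (b : A)
    (hb : ∀ c : A, p • c ≠ b) : ∃ f : A →+ ZMod p, Surjective f := by
  haveI : Fact p.Prime := ⟨hp⟩
  letI : Module (ZMod p) (A ⧸ smulSub A p) := AddCommGroup.zmodModule (by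
    intro x
    induction x using QuotientAddGroup.induction_on with
    | _ a =>
      rw [← QuotientAddGroup.mk_nsmul, QuotientAddGroup.eq_zero_iff]
      exact ⟨a, rfl⟩)
  have hb' : (b : A ⧸ smulSub A p) ≠ 0 := by
    rw [Ne, QuotientAddGroup.eq_zero_iff]
    rintro ⟨c, hc⟩
    exact hb c hc
  obtain ⟨f, hs⟩ := exists_surj_of_ne_zero (ZMod p) _ hb'
  exact ⟨f.comp (QuotientAddGroup.mk' _),
    hs.comp (QuotientAddGroup.mk'_surjective _)⟩

theorem exists_surj_prufer {A : Type u} [AddCommGroup A] (p : ℕ) (hp : p.Prime) (a : A)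
    (ha : p ∣ addOrderOf a) (hdiv : ∀ b : A, ∃ c : A, p • c = b) :
    ∃ f : A →+ PruferGroup p, Surjective f := by
  letI : DivisibleBy (PruferGroup p) ℕ := divisibleByOfSMulRightSurj _ _
    (fun {n} hn x => prufer_divisible p hp n hn x)
  letI : DivisibleBy (PruferGroup p) ℤ := AddGroup.divisibleByIntOfDivisibleByNat _
  have hle : (zmultiplesHom A a).ker ≤ (zmultiplesHom (PruferGroup p) (pruferGen p)).ker := by
    intro k hk
    rw [AddMonoidHom.mem_ker, zmultiplesHom_apply] at hk ⊢
    have h1 : (p : ℤ) ∣ k :=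
      (Int.natCast_dvd_natCast.2 ha).trans (addOrderOf_dvd_iff_zsmul_eq_zero.2 hk)
    obtain ⟨j, rfl⟩ := h1
    rw [mul_comm, mul_smul, natCast_zsmul, pruferGen_smul p hp, smul_zero]
  obtain ⟨f, hf⟩ := (Module.Baer.of_divisible (PruferGroup p)).extension_property_addMonoidHom
    (QuotientAddGroup.kerLift (zmultiplesHom A a)) (QuotientAddGroup.kerLift_injective _)
    (QuotientAddGroup.lift _ (zmultiplesHom (PruferGroup p) (pruferGen p)) hle)
  have hfa : f a = pruferGen p := by
    have := DFunLike.congr_fun hf ((1 : ℤ) : ℤ ⧸ (zmultiplesHom A a).ker)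
    simpa using this
  have key : ∀ (n : ℕ) (x : PruferGroup p), p ^ n • x = 0 → ∃ c, f c = x := by
    intro n
    induction n with
    | zero => intro x hx; exact ⟨0, by rw [map_zero]; simpa using hx.symm⟩
    | succ n ih =>
      intro x hx
      obtain ⟨c, hc⟩ := ih (p • x) (by rw [smul_smul, ← pow_succ]; exact hx)
      obtain ⟨d, rfl⟩ := hdiv c
      obtain ⟨k, hk⟩ := prufer_p_torsion p hp (x - f d) (by
        rw [smul_sub, ← hc, map_nsmul, sub_self])
      exact ⟨k • a + d, by rw [map_add, map_zsmul, hfa, hk, sub_add_cancel]⟩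
  refine ⟨f, fun x => ?_⟩
  obtain ⟨n, hn⟩ := x.2
  exact key n x (Subtype.ext hn)

theorem surj_not_of_relHopfian {G : Type u} [AddCommGroup G] (h : RelativelyHopfian G)
    (Z : Type) [AddCommGroup Z] [Nontrivial Z] : ¬ ∃ γ : G →+ G × Z, Surjective γ := by
  rintro ⟨γ, hγ⟩
  have := h (ULift.{u} Z)
    (((AddMonoidHom.id G).prodMap (AddEquiv.ulift.symm : Z ≃+ ULift.{u} Z).toAddMonoidHom).comp γ)
    ((Surjective.prodMap surjective_id (AddEquiv.ulift.symm : Z ≃+ ULift.{u} Z).surjective).comp hγ)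
  exact not_subsingleton _ this

/-- `G` is relatively Hopfian iff for every prime `p` there is no
surjective homomorphism `G → G ⊕ Z` with `Z = ℤ/pℤ` or `Z = ℤ(p^∞)`. -/
theorem relativelyHopfian_iff_no_cocyclic_surjection (G : Type u) [AddCommGroup G] :
    RelativelyHopfian G ↔
      ∀ p : ℕ, p.Prime →
        (¬ ∃ γ : G →+ G × ZMod p, Surjective γ) ∧
        (¬ ∃ γ : G →+ G × PruferGroup p, Surjective γ) := by
  constructor
  · intro h p hp
    haveI : Fact p.Prime := ⟨hp⟩
    haveI : Nontrivial (PruferGroup p) := ⟨⟨_, _, pruferGen_ne_zero p hp⟩⟩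
    exact ⟨surj_not_of_relHopfian h _, surj_not_of_relHopfian h _⟩
  · intro h A _ φ hφ
    by_contra hA
    rw [not_subsingleton_iff_nontrivial] at hA
    obtain ⟨a, ha⟩ := exists_ne (0 : A)
    have ho : addOrderOf a ≠ 1 := by rwa [Ne, AddMonoid.addOrderOf_eq_one_iff]
    have hp := Nat.minFac_prime ho
    have hd := Nat.minFac_dvd (addOrderOf a)
    generalize (addOrderOf a).minFac = p at hp hd
    by_cases hdiv : ∀ b : A, ∃ c : A, p • c = b
    · obtain ⟨f, hf⟩ := exists_surj_prufer p hp a hd hdiv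
      exact (h p hp).2 ⟨((AddMonoidHom.id G).prodMap f).comp φ,
        (Surjective.prodMap surjective_id hf).comp hφ⟩
    · push Not at hdiv
      obtain ⟨b, hb⟩ := hdiv
      obtain ⟨f, hf⟩ := exists_surj_zmod p hp b hb
      exact (h p hp).1 ⟨((AddMonoidHom.id G).prodMap f).comp φ,
        (Surjective.prodMap surjective_id hf).comp hφ⟩
end

section
/- For a torsion-free abelian group G, the following are equivalent: (a) G is Hopfian; (b) G is relatively Hopfian; (c) G is weakly Hopfian. -/
open Function

universe u

theorem aux_surj {G A : Type u} [AddCommGroup G] [AddCommGroup A] (φ : G →+ G)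
    (hφ : Surjective φ) (r : G →+ A) (hr : ∀ a, ∃ k ∈ φ.ker, r k = a) :
    Surjective (φ.prod r) := by
  rintro ⟨g, a⟩
  obtain ⟨x, rfl⟩ := hφ g
  obtain ⟨k, hk, hka⟩ := hr (a - r x)
  refine ⟨x + k, ?_⟩
  have hk' : φ k = 0 := hk
  ext <;> simp [hk', hka]

theorem aux_pure {G : Type u} [AddCommGroup G] (htf : TorsionFreeGroup G) (φ : G →+ G) :
    IsPureSubgroup φ.ker := by
  rintro n hn x hx ⟨g, rfl⟩
  refine ⟨g, htf _ n hn ?_, rfl⟩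
  rw [← map_nsmul]
  exact hx

theorem aux_functional {G : Type u} [AddCommGroup G] (p : ℕ) [Fact p.Prime] (k : G)
    (hk : ¬ ∃ g : G, p • g = k) : ∃ f : G →+ ZMod p, f k ≠ 0 := by
  have hne : ModN.mkQ p k ≠ 0 := by
    intro h
    apply hk
    have h' : k ∈ LinearMap.range (LinearMap.lsmul ℤ G p) :=
      (Submodule.Quotient.mk_eq_zero _).1 h
    obtain ⟨g, hg⟩ := h'
    exact ⟨g, by simpa using hg⟩
  obtain ⟨f, hf⟩ := Module.Projective.exists_dual_ne_zero (ZMod p) hne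
  exact ⟨f.toAddMonoidHom.comp (ModN.mkQ p), hf⟩

theorem aux_divisible {G : Type u} [AddCommGroup G] (H : AddSubgroup G)
    (hp : ∀ p : ℕ, p.Prime → ∀ x ∈ H, ∃ y ∈ H, p • y = x) :
    IsDivisibleSubgroup H := by
  intro n
  induction n using Nat.recOnMul with
  | zero => intro h; exact absurd h (lt_irrefl _)
  | one => intro _ x hx; exact ⟨x, hx, one_smul _ _⟩
  | prime p h => intro _; exact hp p h
  | mul a b iha ihb =>
    intro h x hx
    obtain ⟨y, hy, rfl⟩ := iha (Nat.pos_of_mul_pos_right h) x hx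
    obtain ⟨z, hz, rfl⟩ := ihb (Nat.pos_of_mul_pos_left h) y hy
    exact ⟨z, hz, mul_smul _ _ _⟩

theorem aux_retract {G : Type u} [AddCommGroup G] (H : AddSubgroup G)
    (hH : IsDivisibleSubgroup H) : ∃ r : G →+ H, ∀ h : H, r h = h := by
  have hs : ∀ {n : ℕ}, n ≠ 0 → Surjective (fun a : H => n • a) := by
    intro n hn x
    obtain ⟨y, hy, hxy⟩ := hH n (Nat.pos_of_ne_zero hn) x x.2
    exact ⟨⟨y, hy⟩, Subtype.ext hxy⟩
  letI : DivisibleBy H ℕ := divisibleByOfSMulRightSurj H ℕ hs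
  letI : DivisibleBy H ℤ := AddGroup.divisibleByIntOfDivisibleByNat H
  obtain ⟨r, hr⟩ := (Module.Baer.of_divisible (A := H) ).extension_property_addMonoidHom
    H.subtype Subtype.val_injective (AddMonoidHom.id H)
  exact ⟨r, fun h => DFunLike.congr_fun hr h⟩

theorem aux_rel {G : Type u} [AddCommGroup G] (htf : TorsionFreeGroup G)
    (hG : RelativelyHopfian G) : Hopfian G := by
  intro φ hφ
  by_cases hdiv : ∀ p : ℕ, p.Prime → ∀ x ∈ φ.ker, ∃ g : G, p • g = x
  · have hd : IsDivisibleSubgroup φ.ker := aux_divisible _ fun p hp x hx =>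
      aux_pure htf φ p hp.pos x hx (hdiv p hp x hx)
    obtain ⟨r, hr⟩ := aux_retract _ hd
    have hsub := hG φ.ker (φ.prod r) (aux_surj φ hφ r fun a => ⟨a, a.2, hr a⟩)
    rw [injective_iff_map_eq_zero]
    intro a ha
    exact congrArg Subtype.val (Subsingleton.elim (⟨a, ha⟩ : φ.ker) 0)
  · exfalso
    push Not at hdiv
    obtain ⟨p, hp, k, hk, hkp⟩ := hdiv
    haveI : Fact p.Prime := ⟨hp⟩
    obtain ⟨f, hf⟩ := aux_functional p k (by rintro ⟨g, hg⟩; exact hkp g hg)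
    let e : ZMod p →+ ULift.{u} (ZMod p) := (AddEquiv.ulift.symm).toAddMonoidHom
    have hsub := hG (ULift.{u} (ZMod p)) (φ.prod (e.comp f)) (aux_surj φ hφ _ (by
      rintro ⟨a⟩
      refine ⟨(a / f k).val • k, AddSubgroup.nsmul_mem _ hk _, ?_⟩
      change ULift.up (f _) = _
      rw [map_nsmul, nsmul_eq_mul, ZMod.natCast_zmod_val, div_mul_cancel₀ _ hf]))
    exact zero_ne_one (congrArg ULift.down
      (Subsingleton.elim (ULift.up (0 : ZMod p)) (ULift.up (1 : ZMod p))))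

theorem aux_hopf {G : Type u} [AddCommGroup G] (hG : Hopfian G) : RelativelyHopfian G := by
  intro A _ φ hφ
  have hinj := hG ((AddMonoidHom.fst G A).comp φ) (Prod.fst_surjective.comp hφ)
  refine ⟨fun a b => ?_⟩
  obtain ⟨x, hx⟩ := hφ (0, a)
  obtain ⟨y, hy⟩ := hφ (0, b)
  have hxy : x = y := hinj (by simp [hx, hy])
  subst hxy
  exact congrArg Prod.snd (hx.symm.trans hy)

/-- For a torsion-free abelian group the notions Hopfian,
relatively Hopfian and weakly Hopfian coincide. -/
theorem torsionFree_hopfian_equivalences (G : Type u) [AddCommGroup G]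
    (htf : TorsionFreeGroup G) :
    (Hopfian G ↔ RelativelyHopfian G) ∧ (RelativelyHopfian G ↔ WeaklyHopfian G) := by
  have hw : WeaklyHopfian G ↔ Hopfian G :=
    ⟨fun h φ hφ => h φ hφ (aux_pure htf φ), fun h φ hφ _ => h φ hφ⟩
  have hr : Hopfian G ↔ RelativelyHopfian G := ⟨aux_hopf, aux_rel htf⟩
  exact ⟨hr, hr.symm.trans hw.symm⟩
end

section
/- Let K and L be abelian groups with Hom(K, L) = 0, and let G = L ⊕ K. Then G is Hopfian (respectively, relatively Hopfian, weakly Hopfian, directly finite) if and only if both L and K are Hopfian (respectively, relatively Hopfian, weakly Hopfian, directly finite). -/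
open Function

universe u

section Aux

variable {K L : Type u} [AddCommGroup K] [AddCommGroup L]

/-- The component `L → L` of a homomorphism out of `L × K`. -/
def auxA {C : Type u} [AddCommGroup C] (φ : L × K →+ L × C) : L →+ L :=
  (AddMonoidHom.fst L C).comp (φ.comp (AddMonoidHom.inl L K))

/-- The component `K → C` of a homomorphism out of `L × K`. -/
def auxD {C : Type u} [AddCommGroup C] (φ : L × K →+ L × C) : K →+ C :=
  (AddMonoidHom.snd L C).comp (φ.comp (AddMonoidHom.inr L K))

theorem aux_zero (hhom : ∀ f : K →+ L, f = 0) {C : Type u} [AddCommGroup C]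
    (φ : L × K →+ L × C) (k : K) : φ (0, k) = (0, auxD φ k) := by
  have h := DFunLike.congr_fun
    (hhom ((AddMonoidHom.fst L C).comp (φ.comp (AddMonoidHom.inr L K)))) k
  exact Prod.ext h rfl

theorem aux_eq (hhom : ∀ f : K →+ L, f = 0) {C : Type u} [AddCommGroup C]
    (φ : L × K →+ L × C) (l : L) (k : K) :
    φ (l, k) = (auxA φ l, (φ (l, 0)).2 + auxD φ k) := by
  have h : φ (l, k) = φ (l, 0) + φ (0, k) := by
    rw [← map_add]; simp
  rw [h, aux_zero hhom]
  exact Prod.ext (by simp [auxA]) (by simp)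

theorem auxA_surj (hhom : ∀ f : K →+ L, f = 0) {C : Type u} [AddCommGroup C]
    (φ : L × K →+ L × C) (hφ : Surjective φ) : Surjective (auxA φ) := by
  intro l
  obtain ⟨⟨x, y⟩, h⟩ := hφ (l, 0)
  rw [aux_eq hhom] at h
  exact ⟨x, (Prod.ext_iff.1 h).1⟩

theorem auxD_surj (hhom : ∀ f : K →+ L, f = 0) {C : Type u} [AddCommGroup C]
    (φ : L × K →+ L × C) (hφ : Surjective φ) (hA : Injective (auxA φ)) :
    Surjective (auxD φ) := by
  intro c
  obtain ⟨⟨x, y⟩, h⟩ := hφ (0, c)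
  rw [aux_eq hhom] at h
  have h1 : auxA φ x = 0 := (Prod.ext_iff.1 h).1
  have h2 : x = 0 := hA (by rw [h1, map_zero])
  subst h2
  have h3 := (Prod.ext_iff.1 h).2
  refine ⟨y, ?_⟩
  have h4 : φ ((0 : L), (0 : K)) = 0 := map_zero φ
  simpa [h4] using h3

theorem auxD_surj' (hhom : ∀ f : K →+ L, f = 0) (hL : RelativelyHopfian L)
    {C : Type u} [AddCommGroup C]
    (φ : L × K →+ L × C) (hφ : Surjective φ) : Surjective (auxD φ) := by
  let q : C →+ C ⧸ (auxD φ).range := QuotientAddGroup.mk' _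
  let ψ : L →+ L × (C ⧸ (auxD φ).range) :=
    (AddMonoidHom.prodMap (AddMonoidHom.id L) q).comp (φ.comp (AddMonoidHom.inl L K))
  have hψ : Surjective ψ := by
    rintro ⟨l, m⟩
    obtain ⟨c, rfl⟩ := QuotientAddGroup.mk'_surjective _ m
    obtain ⟨⟨x, y⟩, h⟩ := hφ (l, c)
    rw [aux_eq hhom] at h
    obtain ⟨h1, h2⟩ := Prod.ext_iff.1 h
    refine ⟨x, Prod.ext h1 ?_⟩
    change q (φ (x, 0)).2 = q c
    have h3 : q (auxD φ y) = 0 := (QuotientAddGroup.eq_zero_iff _).2 ⟨y, rfl⟩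
    have h2' : (φ (x, 0)).2 + auxD φ y = c := h2
    rw [← h2', map_add, h3, add_zero]
  have hs := hL _ ψ hψ
  intro c
  have : q c = 0 := Subsingleton.elim _ _
  exact (QuotientAddGroup.eq_zero_iff _).1 this

theorem aux_inj (hhom : ∀ f : K →+ L, f = 0) {C : Type u} [AddCommGroup C]
    (φ : L × K →+ L × C) (hA : Injective (auxA φ)) (hD : Injective (auxD φ)) :
    Injective φ := by
  rw [injective_iff_map_eq_zero]
  rintro ⟨x, y⟩ h
  have h' := h
  rw [aux_eq hhom] at h
  have h1 : auxA φ x = 0 := (Prod.ext_iff.1 h).1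
  have h2 : x = 0 := hA (by rw [h1, map_zero])
  subst h2
  rw [aux_zero hhom] at h'
  have h3 : auxD φ y = 0 := (Prod.ext_iff.1 h').2
  have h4 : y = 0 := hD (by rw [h3, map_zero])
  rw [h4]; rfl

theorem auxD_inj (hhom : ∀ f : K →+ L, f = 0) {C : Type u} [AddCommGroup C]
    (φ : L × K →+ L × C) (hφ : Injective φ) : Injective (auxD φ) := by
  intro a b h
  have : φ (0, a) = φ (0, b) := by rw [aux_zero hhom, aux_zero hhom, h]
  exact (Prod.ext_iff.1 (hφ this)).2

theorem auxA_pure (hhom : ∀ f : K →+ L, f = 0) {C : Type u} [AddCommGroup C]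
    (φ : L × K →+ L × C) (hφ : Surjective φ) (hp : IsPureSubgroup φ.ker) :
    IsPureSubgroup (auxA φ).ker := by
  rintro n hn l hl ⟨g, rfl⟩
  have hl' : n • auxA φ g = 0 := by
    rw [← map_nsmul]; exact hl
  obtain ⟨⟨x, y⟩, h⟩ := hφ (0, (φ (g, 0)).2)
  have hx : auxA φ x = 0 := by
    have h' := h
    rw [aux_eq hhom] at h'
    exact (Prod.ext_iff.1 h').1
  have hk : n • ((g, 0) - (x, y) : L × K) ∈ φ.ker := by
    rw [AddMonoidHom.mem_ker, map_nsmul, map_sub, h]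
    refine Prod.ext ?_ ?_
    · change n • ((φ (g, 0)).1 - 0) = 0
      rw [sub_zero]; exact hl'
    · change n • ((φ (g, 0)).2 - (φ (g, 0)).2) = 0
      simp
  obtain ⟨⟨a, b⟩, hab, he⟩ := hp n hn _ hk ⟨_, rfl⟩
  have ha : auxA φ a = 0 := by
    rw [AddMonoidHom.mem_ker, aux_eq hhom] at hab
    exact (Prod.ext_iff.1 hab).1
  have he1 : n • a = n • (g - x) := (Prod.ext_iff.1 he).1
  refine ⟨a + x, ?_, ?_⟩
  · rw [AddMonoidHom.mem_ker, map_add, ha, hx, add_zero]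
  · rw [smul_add, he1, smul_sub, sub_add_cancel]

theorem auxD_pure (hhom : ∀ f : K →+ L, f = 0) {C : Type u} [AddCommGroup C]
    (φ : L × K →+ L × C) (hA : Injective (auxA φ)) (hp : IsPureSubgroup φ.ker) :
    IsPureSubgroup (auxD φ).ker := by
  rintro n hn k hk ⟨g, rfl⟩
  have hk' : ((0 : L), n • g) ∈ φ.ker := by
    rw [AddMonoidHom.mem_ker, aux_zero hhom, AddMonoidHom.mem_ker.1 hk]; rfl
  obtain ⟨⟨a, b⟩, hab, he⟩ := hp n hn _ hk' ⟨(0, g), by simp⟩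
  rw [AddMonoidHom.mem_ker] at hab
  have hab' := hab
  rw [aux_eq hhom] at hab
  have h1 : auxA φ a = 0 := (Prod.ext_iff.1 hab).1
  have h2 : a = 0 := hA (by rw [h1, map_zero])
  subst h2
  rw [aux_zero hhom] at hab'
  exact ⟨b, (Prod.ext_iff.1 hab').2, (Prod.ext_iff.1 he).2⟩

theorem auxA_split (hL : DirectlyFinite L)
    (α β : L →+ L) (h : ∀ x, α (β x) = x) : Injective α := by
  let e : L ≃+ L × α.ker :=
    { toFun := fun x => (α x, ⟨x - β (α x), by
        rw [AddMonoidHom.mem_ker, map_sub, h, sub_self]⟩)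
      invFun := fun p => β p.1 + p.2
      left_inv := fun x => by simp
      right_inv := by
        rintro ⟨a, b, hb⟩
        have hb' : α b = 0 := hb
        ext <;> simp [h, hb']
      map_add' := fun x y => by
        ext
        · simp
        · simp; abel }
  have := hL _ e
  rw [injective_iff_map_eq_zero]
  intro x hx
  have : (⟨x, hx⟩ : α.ker) = 0 := Subsingleton.elim _ _
  exact congrArg Subtype.val this

theorem ker_prodMap_pure_left (f : L →+ L) (hp : IsPureSubgroup f.ker) :
    IsPureSubgroup (AddMonoidHom.prodMap f (AddMonoidHom.id K)).ker := by
  rintro n hn ⟨x, y⟩ hx ⟨⟨a, b⟩, hg⟩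
  obtain ⟨h1, h2⟩ := Prod.ext_iff.1 (AddMonoidHom.mem_ker.1 hx)
  obtain ⟨z, hz, hzx⟩ := hp n hn x h1 ⟨a, (Prod.ext_iff.1 hg).1⟩
  refine ⟨(z, 0), ?_, ?_⟩
  · exact Prod.ext hz rfl
  · have h2' : y = 0 := h2
    rw [h2']; exact Prod.ext hzx (smul_zero n)

theorem ker_prodMap_pure_right (f : K →+ K) (hp : IsPureSubgroup f.ker) :
    IsPureSubgroup (AddMonoidHom.prodMap (AddMonoidHom.id L) f).ker := by
  rintro n hn ⟨x, y⟩ hx ⟨⟨a, b⟩, hg⟩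
  obtain ⟨h1, h2⟩ := Prod.ext_iff.1 (AddMonoidHom.mem_ker.1 hx)
  obtain ⟨z, hz, hzx⟩ := hp n hn y h2 ⟨b, (Prod.ext_iff.1 hg).2⟩
  refine ⟨(0, z), ?_, ?_⟩
  · exact Prod.ext rfl hz
  · have h1' : x = 0 := h1
    rw [h1']; exact Prod.ext (smul_zero n) hzx

theorem inj_left (f : L →+ L)
    (h : Injective (AddMonoidHom.prodMap f (AddMonoidHom.id K))) : Injective f := by
  intro a b hab
  have : ((a, 0) : L × K) = (b, 0) := h (Prod.ext hab rfl)
  exact (Prod.ext_iff.1 this).1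

theorem inj_right (f : K →+ K)
    (h : Injective (AddMonoidHom.prodMap (AddMonoidHom.id L) f)) : Injective f := by
  intro a b hab
  have : ((0, a) : L × K) = (0, b) := h (Prod.ext rfl hab)
  exact (Prod.ext_iff.1 this).2

theorem surj_left (f : L →+ L) (h : Surjective f) :
    Surjective (AddMonoidHom.prodMap f (AddMonoidHom.id K)) :=
  Function.Surjective.prodMap h surjective_id

theorem surj_right (f : K →+ K) (h : Surjective f) :
    Surjective (AddMonoidHom.prodMap (AddMonoidHom.id L) f) :=
  Function.Surjective.prodMap surjective_id h

/-- `(L × A) × K ≃ (L × K) × A`. -/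
def auxSwap (L A K : Type u) [AddCommGroup L] [AddCommGroup A] [AddCommGroup K] :
    (L × A) × K ≃+ (L × K) × A where
  toFun p := ((p.1.1, p.2), p.1.2)
  invFun p := ((p.1.1, p.2), p.1.2)
  left_inv _ := rfl
  right_inv _ := rfl
  map_add' _ _ := rfl

end Aux

/-- If `Hom(K, L) = 0` then `L ⊕ K` is in one of the four classes
iff both `L` and `K` are. -/
theorem semi_rigid_sum_classes (K L : Type u) [AddCommGroup K] [AddCommGroup L]
    (hhom : ∀ f : K →+ L, f = 0) :
    (Hopfian (L × K) ↔ Hopfian L ∧ Hopfian K) ∧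
    (RelativelyHopfian (L × K) ↔ RelativelyHopfian L ∧ RelativelyHopfian K) ∧
    (WeaklyHopfian (L × K) ↔ WeaklyHopfian L ∧ WeaklyHopfian K) ∧
    (DirectlyFinite (L × K) ↔ DirectlyFinite L ∧ DirectlyFinite K) := by
  refine ⟨⟨fun h => ⟨fun f hf => ?_, fun f hf => ?_⟩, fun ⟨hL, hK⟩ φ hφ => ?_⟩,
    ⟨fun h => ⟨?_, ?_⟩, fun ⟨hL, hK⟩ => ?_⟩,
    ⟨fun h => ⟨fun f hf hp => ?_, fun f hf hp => ?_⟩, fun ⟨hL, hK⟩ φ hφ hp => ?_⟩,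
    ⟨fun h => ⟨?_, ?_⟩, fun ⟨hL, hK⟩ => ?_⟩⟩
  · exact inj_left f (h _ (surj_left (K := K) f hf))
  · exact inj_right f (h _ (surj_right (L := L) f hf))
  · have hA := hL _ (auxA_surj hhom φ hφ)
    exact aux_inj hhom φ hA (hK _ (auxD_surj hhom φ hφ hA))
  · intro A _ f hf
    exact h A ((auxSwap L A K).toAddMonoidHom.comp
      (AddMonoidHom.prodMap f (AddMonoidHom.id K)))
      ((auxSwap L A K).surjective.comp (Function.Surjective.prodMap hf surjective_id))
  · intro A _ f hf
    exact h A ((AddEquiv.prodAssoc (M := L) (N := K) (P := A)).symm.toAddMonoidHom.comp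
      (AddMonoidHom.prodMap (AddMonoidHom.id L) f))
      ((AddEquiv.prodAssoc (M := L) (N := K) (P := A)).symm.surjective.comp
        (Function.Surjective.prodMap surjective_id hf))
  · intro A _ f hf
    let φ : L × K →+ L × (K × A) :=
      (AddEquiv.prodAssoc (M := L) (N := K) (P := A)).toAddMonoidHom.comp f
    have hφ : Surjective φ :=
      (AddEquiv.prodAssoc (M := L) (N := K) (P := A)).surjective.comp hf
    exact hK A _ (auxD_surj' hhom hL φ hφ)
  · exact inj_left f (h _ (surj_left (K := K) f hf) (ker_prodMap_pure_left f hp))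
  · exact inj_right f (h _ (surj_right (L := L) f hf) (ker_prodMap_pure_right f hp))
  · have hA := hL _ (auxA_surj hhom φ hφ) (auxA_pure hhom φ hφ hp)
    exact aux_inj hhom φ hA
      (hK _ (auxD_surj hhom φ hφ hA) (auxD_pure hhom φ hA hp))
  · intro A _ e
    exact h A ((AddEquiv.prodCongr e (AddEquiv.refl K)).trans (auxSwap L A K))
  · intro A _ e
    exact h A ((AddEquiv.prodCongr (AddEquiv.refl L) e).trans
      (AddEquiv.prodAssoc (M := L) (N := K) (P := A)).symm)
  · intro A _ e
    let e' : L × K ≃+ L × (K × A) := e.trans AddEquiv.prodAssoc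
    let φ : L × K →+ L × (K × A) := e'.toAddMonoidHom
    let β : L →+ L := (AddMonoidHom.fst L K).comp
      (e'.symm.toAddMonoidHom.comp (AddMonoidHom.inl L (K × A)))
    have hA : Injective (auxA φ) := by
      refine auxA_split hL _ β fun x => ?_
      have h1 : φ (e'.symm (x, 0)) = (x, 0) := e'.apply_symm_apply _
      have h2 := aux_eq hhom φ (e'.symm (x, 0)).1 (e'.symm (x, 0)).2
      exact ((Prod.ext_iff.1 h2).1).symm.trans (Prod.ext_iff.1 h1).1
    exact hK A (AddEquiv.ofBijective (auxD φ)
      ⟨auxD_inj hhom φ e'.injective, auxD_surj hhom φ e'.surjective hA⟩)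
end

section
/- Let p be a prime, T an abelian p-group, and k a natural number. Every surjective group homomorphism φ : p^k T → p^k T extends to a surjective group endomorphism γ : T → T (that is, γ restricted to the subgroup p^k T coincides with φ). -/
open Function

universe u

/-- The quotient `G/pG` as a vector space over `ℤ/pℤ`. -/
theorem exists_quotient_aux (p : ℕ) (G : Type u) [AddCommGroup G] :
    ∃ (V : Type u) (_ : AddCommGroup V) (_ : Module (ZMod p) V) (q : G →+ V),
      Surjective q ∧ ∀ x, q x = 0 ↔ ∃ w, p • w = x := by
  have hV : ∀ v : G ⧸ smulSub G p, p • v = 0 := by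
    intro v
    induction v using QuotientAddGroup.induction_on with
    | _ a =>
      rw [← QuotientAddGroup.mk_nsmul]
      exact (QuotientAddGroup.eq_zero_iff _).2 ⟨a, rfl⟩
  exact ⟨G ⧸ smulSub G p, inferInstance, AddCommGroup.zmodModule hV,
    QuotientAddGroup.mk' (smulSub G p), QuotientAddGroup.mk'_surjective _,
    fun x => QuotientAddGroup.eq_zero_iff x⟩

/-- A projection onto a complement of `(pG)[p]` in `G[p]` that kills `pG`. -/
theorem exists_retraction_aux (p : ℕ) (hp : p.Prime) (G : Type u) [AddCommGroup G] :
    ∃ r : G →+ G, (∀ t, r (p • t) = 0) ∧ (∀ t, p • r t = 0) ∧ (∀ t, r (r t) = r t) ∧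
      ∀ s, p • s = 0 → ∃ w, s - r s = p • w := by
  have : Fact p.Prime := ⟨hp⟩
  obtain ⟨V, _, _, q, hqs, hqk⟩ := exists_quotient_aux p G
  have _ : Module (ZMod p) (torsionSub G p) := AddCommGroup.zmodModule (torsionSub_nsmul G p)
  let f : torsionSub G p →ₗ[ZMod p] V :=
    AddMonoidHom.toZModLinearMap p (q.comp (torsionSub G p).subtype)
  have hf : ∀ x, f x = q (x : G) := fun x => rfl
  obtain ⟨g, hg⟩ := LinearMap.exists_leftInverse_of_injective
    (LinearMap.range f).subtype (Submodule.ker_subtype _)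
  obtain ⟨h, hh⟩ := LinearMap.exists_rightInverse_of_surjective f.rangeRestrict
    (LinearMap.range_rangeRestrict f)
  have hg' : ∀ x : LinearMap.range f, g (x : V) = x := fun x => LinearMap.congr_fun hg x
  have hh' : ∀ x : LinearMap.range f, f (h x) = x := fun x =>
    congrArg Subtype.val (LinearMap.congr_fun hh x)
  refine ⟨((torsionSub G p).subtype.comp (h.toAddMonoidHom.comp g.toAddMonoidHom)).comp q,
    ?_, ?_, ?_, ?_⟩
  · intro t
    have : q (p • t) = 0 := (hqk _).2 ⟨t, rfl⟩
    simp [this]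
  · intro t
    exact (h (g (q t))).2
  · intro t
    change ((h (g (q (h (g (q t)) : G))) : torsionSub G p) : G) = (h (g (q t)) : G)
    rw [← hf, hh', hg']
  · intro s hs
    change ∃ w, s - (h (g (q s)) : G) = p • w
    have h1 : q (h (g (q s)) : G) = q s := by
      have h2 : q s = f ⟨s, hs⟩ := rfl
      have h3 : g (q s) = ⟨f ⟨s, hs⟩, LinearMap.mem_range_self f _⟩ := by
        rw [h2]; exact hg' ⟨f ⟨s, hs⟩, LinearMap.mem_range_self f _⟩
      rw [← hf, hh', h3]
      rfl
    have h4 : q (s - (h (g (q s)) : G)) = 0 := by rw [map_sub, h1, sub_self]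
    obtain ⟨w, hw⟩ := (hqk _).1 h4
    exact ⟨w, hw.symm⟩

/-- Any endomorphism of `pG` extends to `G`. -/
theorem exists_extension_aux (p : ℕ) (hp : p.Prime) (G : Type u) [AddCommGroup G]
    (A : Type u) [AddCommGroup A] (i : A →+ G) (hi : Injective i)
    (hr : ∀ x, (∃ a, i a = x) ↔ ∃ y, p • y = x) (φ : A →+ A) :
    ∃ γ : G →+ G, ∀ a, γ (i a) = i (φ a) := by
  have : Fact p.Prime := ⟨hp⟩
  obtain ⟨V, _, _, q, hqs, hqk⟩ := exists_quotient_aux p G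
  have hq0 : ∀ x, q x = 0 → ∃ w, p • w = x := fun x hx =>
    (hqk _).1 hx
  have hqp : ∀ x, q (p • x) = 0 := fun x => (hqk _).2 ⟨x, rfl⟩
  let B := Module.Basis.ofVectorSpace (ZMod p) V
  choose b hb using fun j => hqs (B j)
  choose a ha using fun j => (hr (p • b j)).2 ⟨_, rfl⟩
  choose c hc using fun j => (hr (i (φ (a j)))).1 ⟨_, rfl⟩
  let J := Module.Basis.ofVectorSpaceIndex (ZMod p) V
  let β : (J →₀ ℤ) →ₗ[ℤ] G := Finsupp.linearCombination ℤ b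
  let χ : (J →₀ ℤ) →ₗ[ℤ] G := Finsupp.linearCombination ℤ c
  let α : (J →₀ ℤ) →ₗ[ℤ] A := Finsupp.linearCombination ℤ a
  have hα : ∀ m, i (α m) = p • β m := by
    intro m
    have : (i.toIntLinearMap ∘ₗ α) = p • β := by
      ext j; simp [α, β, ha]
    exact LinearMap.congr_fun this m
  have hχ : ∀ m, i (φ (α m)) = p • χ m := by
    intro m
    have : (i.toIntLinearMap ∘ₗ φ.toIntLinearMap ∘ₗ α) = p • χ := by
      ext j; simp [α, χ, hc]
    exact LinearMap.congr_fun this m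
  have hqβ : ∀ n : J →₀ ℤ, q (β n) =
      Finsupp.linearCombination (ZMod p) B (n.mapRange (Int.cast : ℤ → ZMod p) Int.cast_zero) := by
    intro n
    simp only [β, Finsupp.linearCombination_apply]
    rw [Finsupp.sum_mapRange_index (by simp), Finsupp.sum, Finsupp.sum, map_sum]
    refine Finset.sum_congr rfl fun j _ => ?_
    rw [map_zsmul, hb, Int.cast_smul_eq_zsmul]
  have hker : ∀ n : J →₀ ℤ, q (β n) = 0 → ∃ m : J →₀ ℤ, n = p • m := by
    intro n hn
    rw [hqβ] at hn
    have h0 := (linearIndependent_iff.1 B.linearIndependent) _ hn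
    have hd : ∀ j, (p : ℤ) ∣ n j := by
      intro j
      have := DFunLike.congr_fun h0 j
      rw [← ZMod.intCast_zmod_eq_zero_iff_dvd]
      simpa using this
    refine ⟨n.mapRange (fun z => z / (p : ℤ)) (by simp), ?_⟩
    ext j
    simp [Int.mul_ediv_cancel' (hd j)]
  let P : A × (J →₀ ℤ) →+ G := i.coprod β.toAddMonoidHom
  let Q : A × (J →₀ ℤ) →+ G := (i.comp φ).coprod χ.toAddMonoidHom
  have hPs : Surjective P := by
    intro x
    obtain ⟨n, hn⟩ : ∃ n : J →₀ ℤ, q (β n) = q x := by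
      refine ⟨(B.repr (q x)).mapRange (fun z => (z.val : ℤ)) (by simp), ?_⟩
      rw [hqβ]
      have : (Finsupp.mapRange (Int.cast : ℤ → ZMod p) Int.cast_zero
          ((B.repr (q x)).mapRange (fun z => (z.val : ℤ)) (by simp))) = B.repr (q x) := by
        ext j; simp
      rw [this, B.linearCombination_repr]
    obtain ⟨w, hw⟩ := hq0 (x - β n) (by rw [map_sub, hn, sub_self])
    obtain ⟨a', ha'⟩ := (hr (p • w)).2 ⟨_, rfl⟩
    refine ⟨(a', n), ?_⟩
    change i a' + β n = x
    rw [ha', hw, sub_add_cancel]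
  have hle : P.ker ≤ Q.ker := by
    rintro ⟨a', n⟩ h
    change i a' + β n = 0 at h
    change i (φ a') + χ n = 0
    have hq : q (β n) = 0 := by
      obtain ⟨y, hy⟩ := (hr (i a')).1 ⟨_, rfl⟩
      have := congrArg q h
      rwa [map_add, ← hy, hqp, zero_add, map_zero] at this
    obtain ⟨m, rfl⟩ := hker n hq
    have : a' = - α m := by
      apply hi
      rw [map_neg, hα, ← map_nsmul]
      exact eq_neg_of_add_eq_zero_left h
    rw [this, map_neg, map_neg, hχ, map_nsmul, neg_add_cancel]
  refine ⟨P.liftOfSurjective hPs ⟨Q, hle⟩, fun x => ?_⟩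
  have h1 : P (x, 0) = i x := by simp [P]
  have h2 : Q (x, 0) = i (φ x) := by simp [Q]
  rw [← h1, ← h2]
  exact AddMonoidHom.liftOfRightInverse_comp_apply P _ _ ⟨Q, hle⟩ (x, 0)

/-- The case `k = 1`. -/
theorem extend_step_aux (p : ℕ) (hp : p.Prime) (G : Type u) [AddCommGroup G]
    (A : Type u) [AddCommGroup A] (i : A →+ G) (hi : Injective i)
    (hr : ∀ x, (∃ a, i a = x) ↔ ∃ y, p • y = x) (φ : A →+ A) (hφ : Surjective φ) :
    ∃ γ : G →+ G, Surjective γ ∧ ∀ a, γ (i a) = i (φ a) := by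
  obtain ⟨δ, hδ⟩ := exists_extension_aux p hp G A i hi hr φ
  obtain ⟨r, r1, r2, r3, r4⟩ := exists_retraction_aux p hp G
  have hir : ∀ a, r (i a) = 0 := by
    intro a
    obtain ⟨y, hy⟩ := (hr (i a)).1 ⟨_, rfl⟩
    rw [← hy, r1]
  let γ : G →+ G := δ.comp (AddMonoidHom.id G - r) + r
  have hγ : ∀ x, γ x = δ (x - r x) + r x := fun x => rfl
  have hγi : ∀ a, γ (i a) = i (φ a) := by
    intro a
    rw [hγ, hir, sub_zero, add_zero, hδ]
  have hpG : ∀ w, ∃ x, γ x = p • w := by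
    intro w
    obtain ⟨a, ha⟩ := (hr (p • w)).2 ⟨_, rfl⟩
    obtain ⟨a', rfl⟩ := hφ a
    exact ⟨i a', by rw [hγi, ha]⟩
  refine ⟨γ, fun t => ?_, hγi⟩
  obtain ⟨a, ha⟩ := (hr (p • t)).2 ⟨_, rfl⟩
  obtain ⟨a', rfl⟩ := hφ a
  obtain ⟨y, hy⟩ := (hr (i a')).1 ⟨_, rfl⟩
  have h1 : p • γ y = p • t := by rw [← map_nsmul, hy, hγi, ha]
  obtain ⟨w, hw⟩ := r4 (t - γ y) (by rw [smul_sub, h1, sub_self])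
  obtain ⟨x, hx⟩ := hpG w
  refine ⟨y + r (t - γ y) + x, ?_⟩
  have h2 : γ (r (t - γ y)) = r (t - γ y) := by rw [hγ, r3, sub_self, map_zero, zero_add]
  rw [map_add, map_add, h2, hx, ← hw]
  abel

/-- Every surjective endomorphism of `p^k T` extends to a surjective
endomorphism of the `p`-group `T`. -/
theorem extend_surjective_endomorphism_of_smulSub (p : ℕ) (hp : p.Prime)
    (T : Type u) [AddCommGroup T] (hT : IsPAddGroup T p) (k : ℕ)
    (φ : ↥(smulSub T (p ^ k)) →+ ↥(smulSub T (p ^ k))) (hφ : Surjective φ) :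
    ∃ γ : T →+ T, Surjective γ ∧ ∀ x : ↥(smulSub T (p ^ k)), γ (x : T) = (φ x : T) := by
  clear hT
  induction k with
  | zero =>
    have hm : ∀ x : T, x ∈ smulSub T (p ^ 0) := fun x => ⟨x, by simp [nsmulHom]⟩
    let e : T →+ smulSub T (p ^ 0) := (AddMonoidHom.id T).codRestrict _ hm
    refine ⟨(smulSub T (p ^ 0)).subtype.comp (φ.comp e), fun t => ?_, fun x => rfl⟩
    obtain ⟨y, hy⟩ := hφ ⟨t, hm t⟩
    exact ⟨y, congrArg Subtype.val hy⟩
  | succ k ih =>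
    have hle : smulSub T (p ^ (k + 1)) ≤ smulSub T (p ^ k) := by
      rintro _ ⟨y, rfl⟩
      refine ⟨p • y, ?_⟩
      change p ^ k • p • y = p ^ (k + 1) • y
      rw [pow_succ, mul_smul]
    obtain ⟨ψ, hψ, hψi⟩ := extend_step_aux p hp (smulSub T (p ^ k)) (smulSub T (p ^ (k + 1)))
      (AddSubgroup.inclusion hle) (AddSubgroup.inclusion_injective hle) (by
        intro x
        constructor
        · rintro ⟨⟨_, y, rfl⟩, rfl⟩
          refine ⟨⟨p ^ k • y, y, rfl⟩, Subtype.ext ?_⟩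
          change p • p ^ k • y = p ^ (k + 1) • y
          rw [pow_succ', mul_smul]
        · rintro ⟨⟨_, y, rfl⟩, rfl⟩
          refine ⟨⟨p ^ (k + 1) • y, y, rfl⟩, Subtype.ext ?_⟩
          change p ^ (k + 1) • y = p • p ^ k • y
          rw [pow_succ', mul_smul]) φ hφ
    obtain ⟨γ, hγ, hγi⟩ := ih ψ hψ
    refine ⟨γ, hγ, fun x => ?_⟩
    have h := hγi (AddSubgroup.inclusion hle x)
    rw [hψi] at h
    exact h
end

section
/- Let p be a prime. If A is a relatively Hopfian abelian p-group and B is a finite abelian p-group, then A ⊕ B is relatively Hopfian. -/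
open Function

universe u

theorem cancel_cyclic (p : ℕ) (hp : p.Prime) (k : ℕ) {A Y : Type*} [AddCommGroup A]
    [AddCommGroup Y] (φ : A × ZMod (p ^ k) →+ Y × ZMod (p ^ k)) (hφ : Surjective φ) :
    ∃ g : A →+ Y, Surjective g := by
  have unit_mem : ∀ (R : AddSubgroup Y) (d : ℤ) (y : Y), ¬ (p : ℤ) ∣ d →
      ((p ^ k : ℕ) : ℤ) • y = 0 → d • y ∈ R → y ∈ R := by
    intro R d y hd hy hdy
    have hc : IsCoprime ((p ^ k : ℕ) : ℤ) d := by
      push_cast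
      exact ((Nat.prime_iff_prime_int.mp hp).coprime_iff_not_dvd.mpr hd).pow_left
    obtain ⟨r, s, h⟩ := hc
    have : y = s • d • y := by
      calc y = (1 : ℤ) • y := (one_zsmul y).symm
        _ = (r * ((p ^ k : ℕ) : ℤ) + s * d) • y := by rw [h]
        _ = s • d • y := by rw [add_zsmul, mul_zsmul, mul_zsmul, hy, smul_zero, zero_add]
    rw [this]
    exact R.zsmul_mem hdy s
  obtain ⟨e, he⟩ : ∃ e, φ (0, 1) = e := ⟨_, rfl⟩
  have hsplit : ∀ (a : A) (s : ℤ), φ (a, (s : ZMod (p ^ k))) = φ (a, 0) + s • e := by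
    intro a s
    rw [← he, ← map_zsmul, ← map_add]
    simp
  have hpe : ((p ^ k : ℕ) : ℤ) • e = 0 := by
    rw [← he, ← map_zsmul]
    have : ((p ^ k : ℕ) : ℤ) • ((0, 1) : A × ZMod (p ^ k)) = 0 := by
      ext
      · simp
      · have := ZMod.natCast_self (p ^ k)
        push_cast at this
        simp [this]
    rw [this, map_zero]
  obtain ⟨⟨a0, c'⟩, hb⟩ := hφ (0, 1)
  obtain ⟨c, rfl⟩ := ZMod.intCast_surjective c'
  rw [hsplit] at hb
  obtain ⟨y, t'⟩ := e
  obtain ⟨t, rfl⟩ := ZMod.intCast_surjective t'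
  have hpy : ((p ^ k : ℕ) : ℤ) • y = 0 := congrArg Prod.fst hpe
  -- it suffices to find a suitable map to `Y`
  have key : ∀ ψ : Y × ZMod (p ^ k) →+ Y, (∀ v, ψ (v, 0) = v) →
      ψ (y, (t : ZMod (p ^ k))) ∈ ((ψ.comp φ).comp (AddMonoidHom.inl A _)).range →
      ∃ g : A →+ Y, Surjective g := by
    intro ψ h1 h2
    refine ⟨(ψ.comp φ).comp (AddMonoidHom.inl A _), fun v => ?_⟩
    obtain ⟨⟨a, s'⟩, hv⟩ := hφ (v, 0)
    obtain ⟨s, rfl⟩ := ZMod.intCast_surjective s'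
    rw [hsplit] at hv
    have hv' := congrArg ψ hv
    rw [h1, map_add, map_zsmul] at hv'
    rw [← AddMonoidHom.mem_range, ← hv']
    exact add_mem ⟨a, rfl⟩ (AddSubgroup.zsmul_mem _ h2 s)
  by_cases hc : (p : ℤ) ∣ c
  · let ℓ : ZMod (p ^ k) →+ Y := ZMod.lift (p ^ k) ⟨zmultiplesHom Y y, by simpa using hpy⟩
    have hℓ : ∀ n : ℤ, ℓ (n : ZMod (p ^ k)) = n • y := fun n => by simp [ℓ]
    have hℓ1 : ℓ 1 = y := by simpa using hℓ 1
    refine key ((AddMonoidHom.id Y).coprod ℓ) (by simp) ?_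
    set R := ((((AddMonoidHom.id Y).coprod ℓ).comp φ).comp (AddMonoidHom.inl A _)).range
    have hb' := congrArg ((AddMonoidHom.id Y).coprod ℓ) hb
    rw [map_add, map_zsmul] at hb'
    simp only [AddMonoidHom.coprod_apply (AddMonoidHom.id Y) ℓ (y, _),
      AddMonoidHom.coprod_apply (AddMonoidHom.id Y) ℓ (0, 1), hℓ, hℓ1,
      AddMonoidHom.id_apply, zero_add] at hb'
    have hyR : y ∈ R := by
      refine unit_mem R (1 - c * (1 + t)) y ?_ hpy ⟨a0, ?_⟩
      · intro h
        have h1 : (p : ℤ) ∣ 1 := by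
          have := dvd_add h (hc.mul_right (1 + t))
          simpa using this
        exact (Nat.prime_iff_prime_int.mp hp).not_dvd_one h1
      · have : ((AddMonoidHom.id Y).coprod ℓ) (φ (a0, 0)) = y - c • (y + t • y) :=
          eq_sub_of_add_eq hb'
        refine this.trans ?_
        module
    rw [AddMonoidHom.coprod_apply]
    simp only [hℓ, AddMonoidHom.id_apply]
    exact add_mem hyR (R.zsmul_mem hyR t)
  · refine key (AddMonoidHom.fst _ _) (fun _ => rfl) ?_
    refine unit_mem _ c _ hc hpy ⟨-a0, ?_⟩
    have h1 : (φ (a0, 0)).1 + c • y = 0 := congrArg Prod.fst hb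
    have h2 : φ (-a0, 0) = -φ (a0, 0) := by
      rw [← map_neg]; simp
    change (φ (-a0, 0)).1 = c • y
    rw [h2]
    exact neg_eq_of_add_eq_zero_right h1

/-- `B` can be cancelled from surjections. -/
def SurjCancel (B : Type*) [AddCommGroup B] : Prop :=
  ∀ (A Y : Type u) [AddCommGroup A] [AddCommGroup Y] (φ : A × B →+ Y × B), Surjective φ →
    ∃ g : A →+ Y, Surjective g

theorem SurjCancel.congr {B B' : Type*} [AddCommGroup B] [AddCommGroup B'] (e : B ≃+ B')
    (h : SurjCancel.{u, _} B) : SurjCancel.{u, _} B' := by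
  intro A Y _ _ φ hφ
  let e1 := (AddEquiv.refl A).prodCongr e
  let e2 := (AddEquiv.refl Y).prodCongr e.symm
  exact h A Y ((e2.toAddMonoidHom.comp φ).comp e1.toAddMonoidHom)
    (e2.surjective.comp (hφ.comp e1.surjective))

theorem SurjCancel.prod {B C : Type u} [AddCommGroup B] [AddCommGroup C]
    (hB : SurjCancel.{u, _} B) (hC : SurjCancel.{u, _} C) : SurjCancel.{u, _} (B × C) := by
  intro A Y _ _ φ hφ
  let e1 : (A × B) × C ≃+ A × B × C := AddEquiv.prodAssoc
  let e2 : Y × B × C ≃+ (Y × B) × C := AddEquiv.prodAssoc.symm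
  obtain ⟨g, hg⟩ := hC (A × B) (Y × B) ((e2.toAddMonoidHom.comp φ).comp e1.toAddMonoidHom)
    (e2.surjective.comp (hφ.comp e1.surjective))
  exact hB A Y g hg

theorem surjCancel_pi (n : ℕ) (B : Fin n → Type u) [∀ i, AddCommGroup (B i)]
    (h : ∀ i, SurjCancel.{u, _} (B i)) : SurjCancel.{u, _} (∀ i, B i) := by
  induction n with
  | zero =>
    intro A Y _ _ φ hφ
    refine ⟨((AddMonoidHom.fst _ _).comp φ).comp (AddMonoidHom.inl A _), fun v => ?_⟩
    obtain ⟨⟨a, s⟩, hv⟩ := hφ (v, 0)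
    obtain rfl : s = 0 := Subsingleton.elim _ _
    exact ⟨a, congrArg Prod.fst hv⟩
  | succ n ih =>
    refine SurjCancel.congr ?_ ((h 0).prod (ih (fun i => B i.succ) fun i => h i.succ))
    exact
      { Fin.consEquiv B with
        map_add' := fun x y => by
          funext i
          refine Fin.cases ?_ (fun j => ?_) i <;> simp [Fin.consEquiv] }

theorem surjCancel_finite (B : Type u) [AddCommGroup B] [Finite B] : SurjCancel.{u, _} B := by
  obtain ⟨ι, hι, p, hp, e, ⟨f⟩⟩ := AddCommGroup.equiv_directSum_zmod_of_finite B
  classical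
  let σ := Fintype.equivFin ι
  have h := surjCancel_pi (Fintype.card ι)
    (fun i => ULift.{u} (ZMod (p (σ.symm i) ^ e (σ.symm i)))) (fun i =>
      SurjCancel.congr AddEquiv.ulift.symm (fun A Y _ _ φ hφ => cancel_cyclic _ (hp _) _ φ hφ))
  refine SurjCancel.congr ?_ h
  refine AddEquiv.trans ?_ f.symm
  refine AddEquiv.trans ?_ (DirectSum.addEquivProd _).symm
  refine AddEquiv.trans (AddEquiv.piCongrRight fun i => AddEquiv.ulift) ?_
  exact
    { Equiv.piCongrLeft' (fun i => ZMod (p i ^ e i)) σ |>.symm with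
      map_add' := fun x y => by
        apply (Equiv.piCongrLeft' (fun i => ZMod (p i ^ e i)) σ).injective
        funext i
        simp }

/-- The direct sum of a relatively Hopfian `p`-group and a finite
`p`-group is relatively Hopfian. -/
theorem relativelyHopfian_prod_finite (p : ℕ) (hp : p.Prime)
    (A B : Type u) [AddCommGroup A] [AddCommGroup B]
    (hA : IsPAddGroup A p) (hB : IsPAddGroup B p) [Finite B]
    (hRH : RelativelyHopfian A) : RelativelyHopfian (A × B) := by
  intro C _ φ hφ
  let e : (A × B) × C ≃+ (A × C) × B :=
    { toFun := fun x => ((x.1.1, x.2), x.1.2)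
      invFun := fun x => ((x.1.1, x.2), x.1.2)
      left_inv := fun _ => rfl
      right_inv := fun _ => rfl
      map_add' := fun _ _ => rfl }
  obtain ⟨g, hg⟩ := surjCancel_finite B A (A × C) (e.toAddMonoidHom.comp φ)
    (e.surjective.comp hφ)
  exact hRH C g hg
end

section
/- Let G be a torsion abelian group with p-primary components T_p for each prime p. Then G is Hopfian (respectively, relatively Hopfian, weakly Hopfian, directly finite) if and only if, for every prime p, the primary component T_p is Hopfian (respectively, relatively Hopfian, weakly Hopfian, directly finite). -/
open Function

universe u

section Aux

/-- The elements of order prime to `p`. -/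
def coComp (G : Type u) [AddCommGroup G] (p : ℕ) : AddSubgroup G where
  carrier := {x : G | ∃ n : ℕ, n.Coprime p ∧ n • x = 0}
  zero_mem' := ⟨1, Nat.coprime_one_left p, smul_zero _⟩
  add_mem' := by
    rintro a b ⟨m, hm, hm'⟩ ⟨n, hn, hn'⟩
    refine ⟨m * n, Nat.Coprime.mul_left hm hn, ?_⟩
    rw [smul_add, mul_smul m n b, hn', smul_zero, mul_comm, mul_smul, hm', smul_zero, add_zero]
  neg_mem' := by
    rintro a ⟨n, hn, hn'⟩
    exact ⟨n, hn, by rw [smul_neg, hn', neg_zero]⟩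

variable {G H A T Q : Type u} [AddCommGroup G] [AddCommGroup H] [AddCommGroup A]
  [AddCommGroup T] [AddCommGroup Q]

theorem mem_pC {p : ℕ} {x : G} : x ∈ pComponent G p ↔ ∃ n : ℕ, p ^ n • x = 0 := Iff.rfl

theorem mem_coC {p : ℕ} {x : G} : x ∈ coComp G p ↔ ∃ n : ℕ, n.Coprime p ∧ n • x = 0 := Iff.rfl

theorem eq_zero_of_mem {p : ℕ} {x : G} (h : x ∈ pComponent G p) (h' : x ∈ coComp G p) :
    x = 0 := by
  obtain ⟨n, hn⟩ := h
  obtain ⟨m, hm, hm'⟩ := h'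
  have h1 : addOrderOf x ∣ p ^ n := addOrderOf_dvd_of_nsmul_eq_zero hn
  have h2 : addOrderOf x ∣ m := addOrderOf_dvd_of_nsmul_eq_zero hm'
  have h3 : addOrderOf x = 1 := Nat.eq_one_of_dvd_coprimes (hm.pow_right n) h2 h1
  exact AddMonoid.addOrderOf_eq_one_iff.mp h3

theorem exists_decomp (ht : TorsionGroup G) {p : ℕ} (hp : p.Prime) (x : G) :
    ∃ a ∈ pComponent G p, ∃ b ∈ coComp G p, a + b = x := by
  obtain ⟨n, hn, hx⟩ := ht x
  obtain ⟨k, m, hm, rfl⟩ := Nat.exists_eq_pow_mul_and_not_dvd hn.ne' p hp.ne_one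
  have hc : m.Coprime p := ((Nat.Prime.coprime_iff_not_dvd hp).2 hm).symm
  have hc' : IsCoprime ((m : ℕ) : ℤ) ((p ^ k : ℕ) : ℤ) :=
    Nat.isCoprime_iff_coprime.2 (hc.pow_right k)
  obtain ⟨u, v, huv⟩ := hc'
  refine ⟨u • (m • x), ⟨k, ?_⟩, v • (p ^ k • x), ⟨m, hc, ?_⟩, ?_⟩
  · rw [smul_comm, ← mul_smul (p ^ k) m x, hx, smul_zero]
  · rw [smul_comm, ← mul_smul m (p ^ k) x, mul_comm, hx, smul_zero]
  · rw [← natCast_zsmul, ← natCast_zsmul, ← mul_smul, ← mul_smul, ← add_smul, huv, one_smul]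

theorem exists_split (ht : TorsionGroup G) {p : ℕ} (hp : p.Prime) :
    Nonempty (G ≃+ pComponent G p × coComp G p) := by
  refine ⟨(AddEquiv.ofBijective
    ((pComponent G p).subtype.coprod (coComp G p).subtype) ⟨?_, ?_⟩).symm⟩
  · rw [injective_iff_map_eq_zero]
    rintro ⟨⟨a, ha⟩, ⟨b, hb⟩⟩ h
    have h : a + b = 0 := h
    have hab : a = -b := eq_neg_of_add_eq_zero_left h
    have ha0 : a = 0 := eq_zero_of_mem ha (hab ▸ neg_mem hb)
    have hb0 : b = 0 := by simpa [ha0] using h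
    subst ha0 hb0
    rfl
  · intro x
    obtain ⟨a, ha, b, hb, h⟩ := exists_decomp ht hp x
    exact ⟨(⟨a, ha⟩, ⟨b, hb⟩), h⟩

theorem map_pC {p : ℕ} (φ : G →+ H) {x : G} (hx : x ∈ pComponent G p) :
    φ x ∈ pComponent H p := by
  obtain ⟨n, hn⟩ := hx
  exact ⟨n, by rw [← map_nsmul, hn, map_zero]⟩

theorem map_coC {p : ℕ} (φ : G →+ H) {x : G} (hx : x ∈ coComp G p) :
    φ x ∈ coComp H p := by
  obtain ⟨n, hc, hn⟩ := hx
  exact ⟨n, hc, by rw [← map_nsmul, hn, map_zero]⟩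

/-- Restriction to `p`-components. -/
def resC (p : ℕ) (φ : G →+ H) : pComponent G p →+ pComponent H p :=
  (φ.comp (pComponent G p).subtype).codRestrict (pComponent H p) (fun x => map_pC φ x.2)

theorem resC_coe (p : ℕ) (φ : G →+ H) (x : pComponent G p) : (resC p φ x : H) = φ x := rfl

/-- If the image of `a + b` is in the `p`-component then `b` goes to zero. -/
theorem map_co_zero {p : ℕ} (φ : G →+ H) {a b : G} (ha : a ∈ pComponent G p)
    (hb : b ∈ coComp G p) (h : φ (a + b) ∈ pComponent H p) : φ b = 0 := by
  refine eq_zero_of_mem ?_ (map_coC φ hb)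
  have : φ b = φ (a + b) - φ a := by rw [map_add]; abel
  rw [this]
  exact sub_mem h (map_pC φ ha)

theorem resC_surj (ht : TorsionGroup G) {p : ℕ} (hp : p.Prime) (φ : G →+ H)
    (hφ : Surjective φ) : Surjective (resC p φ) := by
  rintro ⟨y, hy⟩
  obtain ⟨x, rfl⟩ := hφ y
  obtain ⟨a, ha, b, hb, rfl⟩ := exists_decomp ht hp x
  refine ⟨⟨a, ha⟩, Subtype.ext ?_⟩
  rw [resC_coe]
  change φ a = φ (a + b)
  rw [map_add, map_co_zero φ ha hb hy, add_zero]

theorem resC_inj (p : ℕ) (φ : G →+ H) (hφ : Injective φ) : Injective (resC p φ) := by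
  intro x y h
  exact Subtype.ext (hφ (congrArg Subtype.val h))

theorem eq_zero_of_comps {x : G} (hx : ∃ n : ℕ, 0 < n ∧ n • x = 0)
    (h : ∀ p : ℕ, p.Prime → ∀ k : ℕ, k • x ∈ pComponent G p → k • x = 0) : x = 0 := by
  by_contra hne
  have h1 : addOrderOf x ≠ 1 := fun h => hne (AddMonoid.addOrderOf_eq_one_iff.mp h)
  obtain ⟨p, hp, k, hk⟩ := Nat.exists_prime_and_dvd h1
  have hpos : 0 < addOrderOf x := by
    obtain ⟨n, hn, hnx⟩ := hx
    exact Nat.pos_of_dvd_of_pos (addOrderOf_dvd_of_nsmul_eq_zero hnx) hn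
  have h2 : k • x = 0 := h p hp k
    ⟨1, by rw [pow_one, ← mul_smul, ← hk, addOrderOf_nsmul_eq_zero]⟩
  have h3 : addOrderOf x ∣ k := addOrderOf_dvd_of_nsmul_eq_zero h2
  have hk0 : 0 < k := Nat.pos_of_ne_zero (by rintro rfl; rw [mul_zero] at hk; omega)
  have h4 := Nat.le_of_dvd hk0 h3
  have h5 := hp.two_le
  nlinarith

theorem inj_of_res (ht : TorsionGroup G) (φ : G →+ H)
    (h : ∀ p : ℕ, p.Prime → Injective (resC p φ)) : Injective φ := by
  rw [injective_iff_map_eq_zero]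
  intro x hx
  refine eq_zero_of_comps (ht x) (fun p hp k hk => ?_)
  have : (⟨k • x, hk⟩ : pComponent G p) = 0 := by
    apply h p hp
    rw [map_zero]
    apply Subtype.ext
    rw [resC_coe]
    change φ (k • x) = 0
    rw [map_nsmul, hx, smul_zero]
  exact congrArg Subtype.val this

theorem subsingleton_of_comps (ht : TorsionGroup A)
    (h : ∀ p : ℕ, p.Prime → Subsingleton (pComponent A p)) : Subsingleton A := by
  refine subsingleton_of_forall_eq 0 (fun x => eq_zero_of_comps (ht x) (fun p hp k hk => ?_))
  have := h p hp
  exact congrArg Subtype.val (Subsingleton.elim (⟨k • x, hk⟩ : pComponent A p) 0)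

/-- Components of a product. -/
noncomputable def prodC (G A : Type u) [AddCommGroup G] [AddCommGroup A] (p : ℕ) :
    pComponent (G × A) p ≃+ pComponent G p × pComponent A p :=
  AddEquiv.ofBijective ((resC p (AddMonoidHom.fst G A)).prod (resC p (AddMonoidHom.snd G A)))
    ⟨by
      rintro ⟨⟨a, b⟩, hx⟩ ⟨⟨c, d⟩, hy⟩ h
      have h1 : a = c := congrArg (fun z => (z.1 : G)) h
      have h2 : b = d := congrArg (fun z => (z.2 : A)) h
      subst h1 h2
      rfl, by
      rintro ⟨⟨a, ha⟩, ⟨b, hb⟩⟩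
      have h1 : (a, 0) ∈ pComponent (G × A) p := map_pC (AddMonoidHom.inl G A) ha
      have h2 : (0, b) ∈ pComponent (G × A) p := map_pC (AddMonoidHom.inr G A) hb
      have h3 : (a, b) ∈ pComponent (G × A) p := by simpa using add_mem h1 h2
      exact ⟨⟨(a, b), h3⟩, rfl⟩⟩

theorem torsion_of_surj (ht : TorsionGroup G) (φ : G →+ H) (hφ : Surjective φ) :
    TorsionGroup H := by
  intro y
  obtain ⟨x, rfl⟩ := hφ y
  obtain ⟨n, hn, hx⟩ := ht x
  exact ⟨n, hn, by rw [← map_nsmul, hx, map_zero]⟩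

theorem hopf_summand (e : G ≃+ T × Q) (h : Hopfian G) : Hopfian T := by
  intro φ hφ
  have hs : Surjective ((e.symm.toAddMonoidHom.comp (φ.prodMap (AddMonoidHom.id Q))).comp
      e.toAddMonoidHom) :=
    (e.symm.surjective.comp (hφ.prodMap surjective_id)).comp e.surjective
  have hi := h _ hs
  intro x y hxy
  have := @hi (e.symm (x, 0)) (e.symm (y, 0)) (by simp [hxy])
  simpa using this

theorem weak_summand (e : G ≃+ T × Q) (h : WeaklyHopfian G) : WeaklyHopfian T := by
  intro φ hφ hpure
  have hs : Surjective ((e.symm.toAddMonoidHom.comp (φ.prodMap (AddMonoidHom.id Q))).comp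
      e.toAddMonoidHom) :=
    (e.symm.surjective.comp (hφ.prodMap surjective_id)).comp e.surjective
  have hi := h _ hs ?_
  · intro x y hxy
    have := @hi (e.symm (x, 0)) (e.symm (y, 0)) (by simp [hxy])
    simpa using this
  · rintro n hn x hx ⟨g, rfl⟩
    have hx' : e.symm (φ (e (n • g)).1, (e (n • g)).2) = 0 := hx
    rw [EmbeddingLike.map_eq_zero_iff, Prod.mk_eq_zero] at hx'
    obtain ⟨y, hy, hy'⟩ := hpure n hn (e (n • g)).1 hx'.1 ⟨(e g).1, by simp⟩
    refine ⟨e.symm (y, 0), ?_, ?_⟩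
    · have : φ y = 0 := hy
      simp [AddMonoidHom.mem_ker, this]
    · apply e.injective
      rw [map_nsmul, AddEquiv.apply_symm_apply]
      refine Prod.ext hy' ?_
      rw [hx'.2]
      exact smul_zero n

/-- Rearrangement of summands. -/
def shuffle (e : G ≃+ T × Q) (A : Type u) [AddCommGroup A] : (T × A) × Q ≃+ G × A where
  toFun z := (e.symm (z.1.1, z.2), z.1.2)
  invFun w := (((e w.1).1, w.2), (e w.1).2)
  left_inv z := by simp
  right_inv w := by simp
  map_add' z w := by simp [← map_add]

theorem rel_summand (e : G ≃+ T × Q) (h : RelativelyHopfian G) : RelativelyHopfian T := by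
  intro A _ φ hφ
  refine h A (((shuffle e A).toAddMonoidHom.comp (φ.prodMap (AddMonoidHom.id Q))).comp
      e.toAddMonoidHom) ?_
  exact ((shuffle e A).surjective.comp (hφ.prodMap surjective_id)).comp e.surjective

theorem df_summand (e : G ≃+ T × Q) (h : DirectlyFinite G) : DirectlyFinite T := by
  intro A _ φ
  exact h A ((e.trans (φ.prodCongr (AddEquiv.refl Q))).trans (shuffle e A))

theorem res_pure (ht : TorsionGroup G) {p : ℕ} (hp : p.Prime) (φ : G →+ H)
    (h : IsPureSubgroup φ.ker) : IsPureSubgroup (resC p φ).ker := by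
  rintro n hn x hx ⟨g, rfl⟩
  have hx' : φ (n • (g : G)) = 0 := congrArg Subtype.val hx
  obtain ⟨y, hy, hyn⟩ := h n hn (n • (g : G)) hx' ⟨g, rfl⟩
  obtain ⟨a, ha, b, hb, rfl⟩ := exists_decomp ht hp y
  have hy : φ (a + b) = 0 := hy
  have hb0 : φ b = 0 := map_co_zero φ ha hb (by rw [hy]; exact zero_mem _)
  have hnb : nsmulHom G n b = 0 := by
    refine map_co_zero (nsmulHom G n) ha hb ?_
    change n • (a + b) ∈ _
    rw [hyn]
    exact nsmul_mem g.2 n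
  have hnb : n • b = 0 := hnb
  refine ⟨⟨a, ha⟩, ?_, ?_⟩
  · apply Subtype.ext
    rw [resC_coe]
    change φ a = 0
    rwa [map_add, hb0, add_zero] at hy
  · apply Subtype.ext
    change n • a = n • (g : G)
    rw [← hyn, smul_add, hnb, add_zero]

end Aux

/-- A torsion abelian group is in one of the four classes iff every
`p`-primary component is in the corresponding class. -/
theorem torsion_classes_iff_primary_components (G : Type u) [AddCommGroup G]
    (ht : TorsionGroup G) :
    (Hopfian G ↔ ∀ p : ℕ, p.Prime → Hopfian ↥(pComponent G p)) ∧
    (RelativelyHopfian G ↔ ∀ p : ℕ, p.Prime → RelativelyHopfian ↥(pComponent G p)) ∧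
    (WeaklyHopfian G ↔ ∀ p : ℕ, p.Prime → WeaklyHopfian ↥(pComponent G p)) ∧
    (DirectlyFinite G ↔ ∀ p : ℕ, p.Prime → DirectlyFinite ↥(pComponent G p)) := by
  refine ⟨⟨fun h p hp => ?_, fun h => ?_⟩, ⟨fun h p hp => ?_, fun h => ?_⟩,
    ⟨fun h p hp => ?_, fun h => ?_⟩, ⟨fun h p hp => ?_, fun h => ?_⟩⟩
  · exact (exists_split ht hp).elim (fun e => hopf_summand e h)
  · intro φ hφ
    exact inj_of_res ht φ (fun p hp => h p hp _ (resC_surj ht hp φ hφ))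
  · exact (exists_split ht hp).elim (fun e => rel_summand e h)
  · intro A _ φ hφ
    refine subsingleton_of_comps (torsion_of_surj ht ((AddMonoidHom.snd G A).comp φ)
      (Prod.snd_surjective.comp hφ)) (fun p hp => ?_)
    exact h p hp _ ((prodC G A p).toAddMonoidHom.comp (resC p φ))
      ((prodC G A p).surjective.comp (resC_surj ht hp φ hφ))
  · exact (exists_split ht hp).elim (fun e => weak_summand e h)
  · intro φ hφ hpure
    exact inj_of_res ht φ (fun p hp => h p hp _ (resC_surj ht hp φ hφ) (res_pure ht hp φ hpure))
  · exact (exists_split ht hp).elim (fun e => df_summand e h)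
  · intro A _ φ
    refine subsingleton_of_comps (torsion_of_surj ht ((AddMonoidHom.snd G A).comp φ.toAddMonoidHom)
      (Prod.snd_surjective.comp φ.surjective)) (fun p hp => ?_)
    exact h p hp _ ((AddEquiv.ofBijective (resC p φ.toAddMonoidHom)
      ⟨resC_inj p _ φ.injective, resC_surj ht hp _ φ.surjective⟩).trans (prodC G A p))
end

section
/- Let p be a prime. Every abelian p-group T of finite p-rank is relatively Hopfian. -/
open Function

universe u

theorem aux_finite (p : ℕ) [Fact p.Prime] (V : Type u) [AddCommGroup V] [Module (ZMod p) V]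
    (h : Module.rank (ZMod p) V < Cardinal.aleph0) : Finite V := by
  have hmf : Module.Finite (ZMod p) V := Module.rank_lt_aleph0_iff.mp h
  exact Module.finite_of_finite (ZMod p)

theorem aux_card_ker_eq_index (F : Type u) [AddCommGroup F] [Finite F] (n : ℕ) :
    Nat.card (nsmulHom F n).ker = (nsmulHom F n).range.index := by
  have h1 := AddSubgroup.card_mul_index (nsmulHom F n).ker
  have h2 := AddSubgroup.card_mul_index (nsmulHom F n).range
  rw [AddSubgroup.index_ker] at h1
  have h3 : 0 < Nat.card (nsmulHom F n).range := Nat.card_pos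
  rw [← h2, mul_comm] at h1
  exact Nat.eq_of_mul_eq_mul_left h3 h1

theorem aux_card_le (F F' : Type u) [AddCommGroup F] [AddCommGroup F'] [Finite F]
    (f : F →+ F') (hf : Surjective f) (n : ℕ) :
    Nat.card (nsmulHom F' n).ker ≤ Nat.card (nsmulHom F n).ker := by
  haveI : Finite F' := Finite.of_surjective f hf
  rw [aux_card_ker_eq_index, aux_card_ker_eq_index,
    ← AddSubgroup.index_comap_of_surjective _ hf]
  refine AddSubgroup.index_antitone ?_
  rintro _ ⟨y, rfl⟩
  exact ⟨f y, by simp [nsmulHom]⟩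

theorem aux_quot (p : ℕ) (hp : p.Prime) (T Q : Type u) [AddCommGroup T] [AddCommGroup Q]
    (hT : IsPAddGroup T p) [Finite (torsionSub T p)] (φ : T →+ Q) (hφ : Surjective φ)
    (S : Set Q) (hS : S.Finite) (hSp : ∀ s ∈ S, p • s = 0) :
    Nat.card S ≤ Nat.card (torsionSub T p) := by
  let g := surjInv hφ
  let F : AddSubgroup T := AddSubgroup.closure (g '' S)
  have hfg : AddGroup.FG F := by
    rw [AddGroup.fg_iff_addSubgroup_fg, AddSubgroup.fg_iff]
    exact ⟨g '' S, rfl, hS.image g⟩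
  have htor : IsAddTorsion F := by
    intro x
    obtain ⟨n, hn⟩ := hT x.1
    rw [isOfFinAddOrder_iff_nsmul_eq_zero]
    exact ⟨p ^ n, pow_pos hp.pos n, Subtype.ext (by simpa using hn)⟩
  haveI : Finite F := AddCommGroup.finite_of_fg_isAddTorsion F htor
  let f : F →+ F.map φ := φ.addSubgroupMap F
  have hf : Surjective f := φ.addSubgroupMap_surjective F
  have h1 := aux_card_le F (F.map φ) f hf p
  haveI : Finite (F.map φ) := Finite.of_surjective f hf
  have hmem : ∀ s ∈ S, s ∈ F.map φ := fun s hs =>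
    ⟨g s, AddSubgroup.subset_closure ⟨s, hs, rfl⟩, surjInv_eq hφ s⟩
  have h2 : Nat.card S ≤ Nat.card (nsmulHom (F.map φ) p).ker := by
    refine Nat.card_le_card_of_injective
      (fun s : S => ⟨⟨s.1, hmem s.1 s.2⟩, Subtype.ext (hSp s.1 s.2)⟩) ?_
    intro a b hab
    simpa [Subtype.ext_iff] using hab
  have h3 : Nat.card (nsmulHom F p).ker ≤ Nat.card (torsionSub T p) := by
    refine Nat.card_le_card_of_injective
      (fun s : (nsmulHom F p).ker => (⟨s.1.1, congrArg Subtype.val s.2⟩ : torsionSub T p)) ?_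
    intro a b hab
    have hv : a.1.1 = b.1.1 := congrArg (fun z : torsionSub T p => z.1) hab
    exact Subtype.ext (Subtype.ext hv)
  omega

/-- Every `p`-group of finite `p`-rank is relatively Hopfian. -/
theorem relativelyHopfian_of_finite_pRank (p : ℕ) (hp : p.Prime)
    (T : Type u) [AddCommGroup T] (hT : IsPAddGroup T p)
    (hr : pRank T p < Cardinal.aleph0) : RelativelyHopfian T := by
  haveI : Fact p.Prime := ⟨hp⟩
  haveI hfin : Finite (torsionSub T p) := by
    exact @aux_finite p ⟨hp⟩ ↥(torsionSub T p) _
      (AddCommGroup.zmodModule (torsionSub_nsmul T p)) hr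
  intro A _ φ hφ
  have key : ∀ a : A, p • a = 0 → a = 0 := by
    intro a ha
    by_contra hne
    have hTf : (torsionSub T p : Set T).Finite := hfin
    have h := aux_quot p hp T (T × A) hT φ hφ ((torsionSub T p : Set T) ×ˢ ({0, a} : Set A))
      (hTf.prod (by simp)) (by
        rintro ⟨t, b⟩ ⟨ht, hb⟩
        have ht' : p • t = 0 := ht
        rcases hb with hb | hb
        · have hb' : b = 0 := hb
          simp [ht', hb']
        · have hb' : b = a := hb
          simp [ht', hb', ha])
    rw [Nat.card_coe_set_eq, Set.ncard_prod, Set.ncard_pair (Ne.symm hne),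
      ← Nat.card_coe_set_eq] at h
    have hpos : 0 < Nat.card (torsionSub T p) := Nat.card_pos
    change Nat.card (torsionSub T p) * 2 ≤ _ at h
    omega
  have key2 : ∀ (n : ℕ) (a : A), p ^ n • a = 0 → a = 0 := by
    intro n
    induction n with
    | zero => intro a ha; simpa using ha
    | succ n ih =>
      intro a ha
      apply key
      apply ih
      rwa [← mul_smul, ← pow_succ]
  refine ⟨fun a b => ?_⟩
  have hz : ∀ a : A, a = 0 := by
    intro a
    obtain ⟨t, ht⟩ := hφ (0, a)
    obtain ⟨n, hn⟩ := hT t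
    apply key2 n
    have := congrArg Prod.snd (congrArg φ hn)
    simpa [ht] using this
  rw [hz a, hz b]
end

section
/- Let D be a divisible abelian group, with D = D_0 ⊕ (⊕_p D_p) where D_0 is torsion-free and each D_p is the p-primary component of D. Then D is relatively Hopfian (equivalently, weakly Hopfian, equivalently, directly finite) if and only if D_0 has finite rank and, for every prime p, D_p has finite p-rank. -/
open Function

universe u

section Helpers

theorem aux_card_torsion_finite {E F : Type u} [AddCommGroup E] [AddCommGroup F] [Finite F]
    [Finite E] (f : F →+ E) (hf : Surjective f) (n : ℕ) :
    Nat.card (torsionSub E n) ≤ Nat.card (torsionSub F n) := by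
  have key : ∀ (H : Type u) [AddCommGroup H] [Finite H],
      Nat.card (torsionSub H n) = (smulSub H n).index := by
    intro H _ _
    have h1 := (nsmulHom H n).ker.card_mul_index
    have h2 := (nsmulHom H n).range.card_mul_index
    rw [AddSubgroup.index_ker] at h1
    have h3 : 0 < Nat.card (nsmulHom H n).range := Nat.card_pos
    have : Nat.card (nsmulHom H n).range * Nat.card (nsmulHom H n).ker =
      Nat.card (nsmulHom H n).range * (nsmulHom H n).range.index := by
      rw [h2, mul_comm, h1]
    exact Nat.eq_of_mul_eq_mul_left h3 this
  rw [key, key]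
  have hm : (smulSub F n).map f = smulSub E n := by
    ext y
    constructor
    · rintro ⟨_, ⟨x, rfl⟩, rfl⟩
      exact ⟨f x, (map_nsmul f n x).symm⟩
    · rintro ⟨z, rfl⟩
      obtain ⟨x, rfl⟩ := hf z
      exact ⟨_, ⟨x, rfl⟩, map_nsmul f n x⟩
  rw [← hm]
  apply Nat.le_of_dvd
  · exact Nat.pos_of_ne_zero AddSubgroup.index_ne_zero_of_finite
  · exact AddSubgroup.index_map_dvd _ hf

theorem aux_card_le_s10 {T B : Type u} [AddCommGroup T] [AddCommGroup B] (hT : TorsionGroup T)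
    (n : ℕ) (hfin : Finite (torsionSub T n)) (f : T →+ B) (hf : Surjective f)
    (s : Finset B) (hs : ∀ b ∈ s, n • b = 0) : s.card ≤ Nat.card (torsionSub T n) := by
  classical
  let F : AddSubgroup T := AddSubgroup.closure ((s.image (surjInv hf) : Finset T) : Set T)
  have : AddGroup.FG F := inferInstanceAs (AddGroup.FG (AddSubgroup.closure _))
  have : Finite F := by
    apply AddCommGroup.finite_of_fg_isAddTorsion
    intro x
    obtain ⟨m, hm, hx⟩ := hT x
    rw [isOfFinAddOrder_iff_nsmul_eq_zero]
    exact ⟨m, hm, by ext; exact hx⟩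
  let E : AddSubgroup B := F.map f
  let g : F →+ E := f.addSubgroupMap F
  have hg : Surjective g := f.addSubgroupMap_surjective F
  have : Finite E := Finite.of_surjective g hg
  have h1 := aux_card_torsion_finite g hg n
  have h2 : Nat.card (torsionSub F n) ≤ Nat.card (torsionSub T n) := by
    refine Nat.card_le_card_of_injective
      (fun x => (⟨x.1.1, ?_⟩ : torsionSub T n)) ?_
    · have := x.2
      exact congrArg Subtype.val (show n • x.1 = 0 from this)
    · intro x y hxy
      apply Subtype.ext
      apply Subtype.ext
      exact congrArg (fun z : torsionSub T n => z.1) hxy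
  have h3 : s.card ≤ Nat.card (torsionSub E n) := by
    have hsc : Nat.card s = s.card := by simp
    rw [← hsc]
    refine Nat.card_le_card_of_injective
      (fun x => (⟨⟨x.1, surjInv hf x.1, ?_, surjInv_eq hf x.1⟩, ?_⟩ : torsionSub E n)) ?_
    · apply AddSubgroup.subset_closure
      simp only [Finset.coe_image]
      exact ⟨x.1, x.2, rfl⟩
    · refine AddMonoidHom.mem_ker.mpr (Subtype.ext ?_)
      exact hs x.1 x.2
    · intro x y hxy
      ext
      exact congrArg (fun z : torsionSub E n => (z.1.1 : B)) hxy
  omega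

theorem aux_torsion_case {T A : Type u} [AddCommGroup T] [AddCommGroup A] (hT : TorsionGroup T)
    (hfin : ∀ p : ℕ, p.Prime → Finite (torsionSub T p)) (f : T →+ T × A) (hf : Surjective f) :
    Subsingleton A := by
  classical
  by_contra hA
  rw [not_subsingleton_iff_nontrivial] at hA
  obtain ⟨a, ha⟩ := exists_ne (0 : A)
  have hfa : IsOfFinAddOrder a := by
    obtain ⟨t, ht⟩ := hf (0, a)
    obtain ⟨m, hm, hx⟩ := hT t
    rw [isOfFinAddOrder_iff_nsmul_eq_zero]
    refine ⟨m, hm, ?_⟩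
    have := congrArg Prod.snd (congrArg f hx)
    rw [map_nsmul, ht] at this
    simpa using this
  have h1 : addOrderOf a ≠ 1 := by
    rw [Ne, AddMonoid.addOrderOf_eq_one_iff]; exact ha
  obtain ⟨p, hp, k, hk⟩ := Nat.exists_prime_and_dvd h1
  have hpos : 0 < addOrderOf a := hfa.addOrderOf_pos
  have hkpos : 0 < k := by
    rcases Nat.eq_zero_or_pos k with h | h
    · subst h; omega
    · exact h
  have hb0 : k • a ≠ 0 := by
    intro h
    have := Nat.le_of_dvd hkpos (addOrderOf_dvd_of_nsmul_eq_zero h)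
    have := hp.two_le
    nlinarith
  have hpb : p • (k • a) = 0 := by
    rw [← mul_smul, ← hk, addOrderOf_nsmul_eq_zero]
  have := hfin p hp
  have : Fintype (torsionSub T p) := Fintype.ofFinite _
  let s : Finset (T × A) :=
    ((Finset.univ : Finset (torsionSub T p)).image Subtype.val) ×ˢ {0, k • a}
  have hs := aux_card_le_s10 hT p (hfin p hp) f hf s (by
    rintro ⟨t, b⟩ hb
    simp only [s, Finset.mem_product, Finset.mem_image, Finset.mem_insert,
      Finset.mem_singleton] at hb
    obtain ⟨⟨x, -, rfl⟩, h | h⟩ := hb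
    · subst h
      exact Prod.ext x.2 (smul_zero p)
    · subst h
      exact Prod.ext x.2 hpb)
  have hc : s.card = Nat.card (torsionSub T p) * 2 := by
    rw [Finset.card_product, Finset.card_image_of_injective _ Subtype.val_injective,
      Finset.card_pair hb0.symm, Finset.card_univ, Nat.card_eq_fintype_card]
  have : 0 < Nat.card (torsionSub T p) := Nat.card_pos
  omega

theorem aux_rank_prod (M N : Type u) [AddCommGroup M] [AddCommGroup N] :
    Module.rank ℤ (M × N) = Module.rank ℤ M + Module.rank ℤ N := by
  have h := LinearMap.rank_range_add_rank_ker (LinearMap.snd ℤ M N)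
  rw [LinearMap.range_eq_top.mpr Prod.snd_surjective, rank_top, LinearMap.ker_snd,
    ← (LinearEquiv.ofInjective _ LinearMap.inl_injective).rank_eq] at h
  rw [← h, add_comm]

/-- Finite `ℤ`-rank and finite `p`-torsion imply relatively Hopfian. -/
theorem aux_relHopf {D : Type u} [AddCommGroup D] (hr : Module.rank ℤ D < Cardinal.aleph0)
    (hfin : ∀ p : ℕ, p.Prime → Finite (torsionSub D p)) : RelativelyHopfian D := by
  intro A _ φ hφ
  let L := φ.toIntLinearMap
  have hL : LinearMap.range L = ⊤ := LinearMap.range_eq_top.mpr hφ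
  have h1 := LinearMap.rank_range_add_rank_ker L
  rw [hL, rank_top, aux_rank_prod] at h1
  obtain ⟨d, hd⟩ := Cardinal.lt_aleph0.mp hr
  have hle1 : Module.rank ℤ A ≤ Module.rank ℤ D := by
    rw [← h1, add_right_comm]; exact le_add_self
  have hle2 : Module.rank ℤ (LinearMap.ker L) ≤ Module.rank ℤ D := by
    rw [← h1]; exact le_add_self
  obtain ⟨a, ha⟩ := Cardinal.lt_aleph0.mp (hle1.trans_lt hr)
  obtain ⟨b, hb⟩ := Cardinal.lt_aleph0.mp (hle2.trans_lt hr)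
  rw [hd, ha, hb] at h1
  norm_cast at h1
  have ha0 : a = 0 := by omega
  have hb0 : b = 0 := by omega
  rw [ha0, Nat.cast_zero, rank_eq_zero_iff] at ha
  rw [hb0, Nat.cast_zero, rank_eq_zero_iff] at hb
  have nat_of_int : ∀ {M : Type u} [AddCommGroup M] (x : M), (∃ a : ℤ, a ≠ 0 ∧ a • x = 0) →
      IsOfFinAddOrder x := by
    rintro M _ x ⟨a, ha, hx⟩
    exact isOfFinAddOrder_iff_zsmul_eq_zero.mpr ⟨a, ha, hx⟩
  let T := AddCommGroup.torsion D
  have hTt : ∀ x : D, x ∈ T ↔ IsOfFinAddOrder x := fun x => Iff.rfl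
  let f : T →+ T × A :=
    { toFun := fun x => (⟨(φ x).1, by
          have hx : IsOfFinAddOrder x.1 := x.2
          exact ((AddMonoidHom.fst D A).comp φ).isOfFinAddOrder hx⟩, (φ x).2)
      map_zero' := by ext <;> simp
      map_add' := by intro x y; ext <;> simp }
  refine aux_torsion_case (T := T) ?_ ?_ f ?_
  · intro x
    have hx : IsOfFinAddOrder x.1 := x.2
    obtain ⟨n, hn, h⟩ := isOfFinAddOrder_iff_nsmul_eq_zero.mp hx
    exact ⟨n, hn, by ext; exact h⟩
  · intro p hp
    have := hfin p hp
    refine Finite.of_injective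
      (fun x : torsionSub T p => (⟨x.1.1, congrArg Subtype.val (show p • x.1 = 0 from x.2)⟩ :
        torsionSub D p)) ?_
    intro x y hxy
    apply Subtype.ext
    apply Subtype.ext
    exact congrArg (fun z : torsionSub D p => z.1) hxy
  · rintro ⟨t, c⟩
    obtain ⟨x, hx⟩ := hφ (t.1, c)
    have hxT : IsOfFinAddOrder x := by
      obtain ⟨n, hn, h⟩ := isOfFinAddOrder_iff_nsmul_eq_zero.mp (show IsOfFinAddOrder t.1 from t.2)
      obtain ⟨m, hm, h'⟩ := isOfFinAddOrder_iff_nsmul_eq_zero.mp (nat_of_int c (ha c))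
      have hker : (m * n) • x ∈ LinearMap.ker L := by
        show φ ((m * n) • x) = 0
        rw [map_nsmul, hx]
        refine Prod.ext ?_ ?_
        · show (m * n) • t.1 = 0
          rw [mul_smul, h, smul_zero]
        · show (m * n) • c = 0
          rw [mul_comm, mul_smul, h', smul_zero]
      obtain ⟨k, hk, hk'⟩ := isOfFinAddOrder_iff_nsmul_eq_zero.mp (nat_of_int _ (hb ⟨_, hker⟩))
      have hk2 : k • ((m * n) • x) = 0 := congrArg Subtype.val hk'
      rw [← mul_smul] at hk2
      exact isOfFinAddOrder_iff_nsmul_eq_zero.mpr ⟨_, by positivity, hk2⟩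
    refine ⟨⟨x, hxT⟩, ?_⟩
    refine Prod.ext ?_ ?_
    · ext
      show (φ x).1 = t.1
      rw [hx]
    · show (φ x).2 = c
      rw [hx]

theorem aux_baer {Q : Type u} [AddCommGroup Q] (h : DivisibleGroup Q) : Module.Baer ℤ Q := by
  let _ : DivisibleBy Q ℤ := divisibleByOfSMulRightSurj Q ℤ (by
    intro n hn y
    obtain ⟨x, hx⟩ := h n.natAbs (Int.natAbs_pos.mpr hn) y
    rcases Int.natAbs_eq n with h' | h'
    · refine ⟨x, ?_⟩
      show n • x = y
      rw [h', natCast_zsmul, hx]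
    · refine ⟨-x, ?_⟩
      show n • (-x) = y
      rw [h', neg_smul, smul_neg, neg_neg, natCast_zsmul, hx])
  exact Module.Baer.of_divisible Q

theorem aux_DF_of_RH {D : Type u} [AddCommGroup D] (h : RelativelyHopfian D) :
    DirectlyFinite D := fun A _ e => h A e.toAddMonoidHom e.surjective

theorem aux_DF_of_WH {D : Type u} [AddCommGroup D] (h : WeaklyHopfian D) :
    DirectlyFinite D := by
  intro A _ e
  have hinj := h ((AddMonoidHom.fst D A).comp e.toAddMonoidHom)
    (fun y => ⟨e.symm (y, 0), by simp⟩) (by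
      intro n hn x hx ⟨g, hg⟩
      have hx' : (e x).1 = 0 := hx
      refine ⟨e.symm (0, (e g).2), ?_, ?_⟩
      · show (e (e.symm (0, (e g).2))).1 = 0
        simp
      · apply e.injective
        rw [map_nsmul, e.apply_symm_apply, ← hg, map_nsmul]
        rw [← hg, map_nsmul] at hx'
        refine Prod.ext ?_ rfl
        show n • (0 : D) = _
        rw [hx', smul_zero])
  refine ⟨fun a b => ?_⟩
  have := @hinj (e.symm (0, a)) (e.symm (0, b)) (by simp)
  simpa using this

theorem aux_WH_of_DF {D : Type u} [AddCommGroup D] (hdiv : DivisibleGroup D)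
    (h : DirectlyFinite D) : WeaklyHopfian D := by
  intro φ hφ hK
  have hKd : DivisibleGroup φ.ker := by
    intro n hn x
    obtain ⟨y, hy, hyx⟩ := hK n hn x.1 x.2 (hdiv n hn x.1)
    exact ⟨⟨y, hy⟩, by ext; exact hyx⟩
  obtain ⟨r, hr⟩ := (aux_baer hKd).extension_property_addMonoidHom φ.ker.subtype
    Subtype.val_injective (AddMonoidHom.id _)
  have hr' : ∀ k : φ.ker, r k.1 = k := fun k => DFunLike.congr_fun hr k
  have hbij : Bijective (φ.prod r) := by
    constructor
    · rw [injective_iff_map_eq_zero]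
      intro x hx
      have h1 : φ x = 0 := congrArg Prod.fst hx
      have h2 : r x = 0 := congrArg Prod.snd hx
      have := hr' ⟨x, h1⟩
      rw [h2] at this
      exact (congrArg Subtype.val this).symm
    · rintro ⟨y, k⟩
      obtain ⟨x, rfl⟩ := hφ y
      refine ⟨x + (k - r x : φ.ker).1, ?_⟩
      have h1 : φ ((k - r x : φ.ker).1) = 0 := (k - r x : φ.ker).2
      refine Prod.ext ?_ ?_
      · show φ (x + (k - r x : φ.ker).1) = φ x
        rw [map_add, h1, add_zero]
      · show r (x + (k - r x : φ.ker).1) = k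
        rw [map_add, hr']
        abel
  have hs := h φ.ker (AddEquiv.ofBijective _ hbij)
  rw [injective_iff_map_eq_zero]
  intro x hx
  exact congrArg Subtype.val (hs.elim (⟨x, hx⟩ : φ.ker) 0)

theorem aux_retract_s10 {D B : Type u} [AddCommGroup D] [AddCommGroup B] (h : DirectlyFinite D)
    (i : B →+ D) (r : D →+ B) (hri : ∀ b, r (i b) = b) (e : B ≃+ B × B) : Subsingleton B := by
  refine h B
    { toFun := fun x => (x + i ((e (r x)).1 - r x), (e (r x)).2)
      invFun := fun y => y.1 + i (e.symm (r y.1, y.2) - r y.1)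
      left_inv := ?_
      right_inv := ?_
      map_add' := ?_ }
  · intro x
    simp [hri]
    abel
  · rintro ⟨y, a⟩
    simp [hri]
    abel
  · intro x y
    ext
    · simp; abel
    · simp

theorem aux_pgroup_equiv {T T' : Type u} [AddCommGroup T] [AddCommGroup T'] (p : ℕ)
    (hT : IsPAddGroup T p) (hT' : IsPAddGroup T' p) (hpos : 0 < p)
    (hd : DivisibleGroup T) (hd' : DivisibleGroup T')
    (e : torsionSub T p ≃+ torsionSub T' p) : Nonempty (T ≃+ T') := by
  obtain ⟨g, hg⟩ := (aux_baer hd').extension_property_addMonoidHom (torsionSub T p).subtype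
    Subtype.val_injective ((torsionSub T' p).subtype.comp e.toAddMonoidHom)
  have hg' : ∀ k : torsionSub T p, g k.1 = (e k).1 := fun k => DFunLike.congr_fun hg k
  refine ⟨AddEquiv.ofBijective g ⟨?_, ?_⟩⟩
  · rw [injective_iff_map_eq_zero]
    have : ∀ n : ℕ, ∀ x : T, p ^ n • x = 0 → g x = 0 → x = 0 := by
      intro n
      induction n with
      | zero => intro x hx _; simpa using hx
      | succ n ih =>
        intro x hx hgx
        have h1 : p • x = 0 := by
          apply ih
          · rw [← mul_smul, ← pow_succ, hx]
          · rw [map_nsmul, hgx, smul_zero]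
        have h2 := hg' ⟨x, h1⟩
        have h3 : e ⟨x, h1⟩ = 0 := by
          ext
          rw [← h2]
          exact hgx
        rw [EmbeddingLike.map_eq_zero_iff] at h3
        exact congrArg Subtype.val h3
    intro x hx
    obtain ⟨n, hn⟩ := hT x
    exact this n x hn hx
  · have : ∀ n : ℕ, ∀ y : T', p ^ n • y = 0 → ∃ x, g x = y := by
      intro n
      induction n with
      | zero => intro y hy; exact ⟨0, by simpa using hy.symm⟩
      | succ n ih =>
        intro y hy
        obtain ⟨x, hx⟩ := ih (p • y) (by rw [← mul_smul, ← pow_succ, hy])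
        obtain ⟨x', rfl⟩ := hd p hpos x
        have h1 : p • (y - g x') = 0 := by
          rw [smul_sub, ← hx, map_nsmul, sub_self]
        have h2 := hg' (e.symm ⟨y - g x', h1⟩)
        rw [e.apply_symm_apply] at h2
        exact ⟨(e.symm ⟨y - g x', h1⟩).1 + x', by rw [map_add, h2]; simp⟩
    intro y
    obtain ⟨n, hn⟩ := hT' y
    exact this n y hn

theorem aux_self_prod {K V : Type*} [Field K] [AddCommGroup V] [Module K V]
    (h : Cardinal.aleph0 ≤ Module.rank K V) : Nonempty (V ≃ₗ[K] V × V) := by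
  apply nonempty_linearEquiv_of_rank_eq
  rw [rank_prod', Cardinal.add_eq_self h]

theorem aux_p_self_prod {T : Type u} [AddCommGroup T] (p : ℕ) (hp : p.Prime)
    (hT : IsPAddGroup T p) (hd : DivisibleGroup T) (h : Cardinal.aleph0 ≤ pRank T p) :
    Nonempty (T ≃+ T × T) := by
  have : Fact p.Prime := ⟨hp⟩
  let _ : Module (ZMod p) (torsionSub T p) := AddCommGroup.zmodModule (torsionSub_nsmul T p)
  obtain ⟨e⟩ := aux_self_prod (K := ZMod p) (V := torsionSub T p) h
  let e2 : (torsionSub T p × torsionSub T p) ≃+ torsionSub (T × T) p :=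
    { toFun := fun x => ⟨(x.1.1, x.2.1), Prod.ext x.1.2 x.2.2⟩
      invFun := fun y => (⟨y.1.1, congrArg Prod.fst (show p • y.1 = 0 from y.2)⟩,
        ⟨y.1.2, congrArg Prod.snd (show p • y.1 = 0 from y.2)⟩)
      left_inv := fun _ => rfl
      right_inv := fun _ => rfl
      map_add' := fun _ _ => rfl }
  refine aux_pgroup_equiv p hT ?_ hp.pos hd ?_ (e.toAddEquiv.trans e2)
  · rintro ⟨x, y⟩
    obtain ⟨m, hm⟩ := hT x
    obtain ⟨n, hn⟩ := hT y
    refine ⟨m + n, Prod.ext ?_ ?_⟩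
    · show p ^ (m + n) • x = 0
      rw [pow_add, mul_comm, mul_smul, hm, smul_zero]
    · show p ^ (m + n) • y = 0
      rw [pow_add, mul_smul, hn, smul_zero]
  · rintro n hn ⟨x, y⟩
    obtain ⟨x', rfl⟩ := hd n hn x
    obtain ⟨y', rfl⟩ := hd n hn y
    exact ⟨(x', y'), rfl⟩

theorem aux_fin {K V : Type*} [Field K] [Finite K] [AddCommGroup V] [Module K V]
    (h : Module.rank K V < Cardinal.aleph0) : Finite V := by
  have : Module.Finite K V := Module.rank_lt_aleph0_iff.mp h
  exact Module.finite_of_finite K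

theorem aux_pRank_finite {T : Type u} [AddCommGroup T] (p : ℕ) (hp : p.Prime)
    (h : pRank T p < Cardinal.aleph0) : Finite (torsionSub T p) := by
  have : Fact p.Prime := ⟨hp⟩
  let _ : Module (ZMod p) (torsionSub T p) := AddCommGroup.zmodModule (torsionSub_nsmul T p)
  exact aux_fin (K := ZMod p) (V := torsionSub T p) h

theorem aux_rationalRank (G : Type u) [AddCommGroup G] :
    rationalRank G = Module.rank ℤ G :=
  (TensorProduct.isBaseChange ℤ G ℚ).rank_eq

theorem aux_q_self_prod {G : Type u} [AddCommGroup G] (hG : TorsionFreeGroup G)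
    (hd : DivisibleGroup G) (h : Cardinal.aleph0 ≤ rationalRank G) : Nonempty (G ≃+ G × G) := by
  obtain ⟨e⟩ := aux_self_prod (K := ℚ) (V := TensorProduct ℤ ℚ G) h
  have hinj : ∀ n : ℤ, n ≠ 0 → ∀ x : G, n • x = 0 → x = 0 := by
    intro n hn x hx
    refine hG x n.natAbs (Int.natAbs_pos.mpr hn) ?_
    rcases Int.natAbs_eq n with h' | h'
    · rw [h', natCast_zsmul] at hx; exact hx
    · rw [h', neg_smul, natCast_zsmul, neg_eq_zero] at hx; exact hx
  have hsurj : ∀ n : ℤ, n ≠ 0 → ∀ y : G, ∃ x, n • x = y := by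
    intro n hn y
    obtain ⟨x, hx⟩ := hd n.natAbs (Int.natAbs_pos.mpr hn) y
    rcases Int.natAbs_eq n with h' | h'
    · exact ⟨x, by rw [h', natCast_zsmul, hx]⟩
    · exact ⟨-x, by rw [h', neg_smul, smul_neg, neg_neg, natCast_zsmul, hx]⟩
  have : IsLocalizedModule (nonZeroDivisors ℤ) (LinearMap.id : G →ₗ[ℤ] G) :=
    { map_units := by
        intro s
        rw [Module.End.isUnit_iff]
        constructor
        · rw [injective_iff_map_eq_zero]
          exact fun x hx => hinj s.1 (nonZeroDivisors.coe_ne_zero s) x hx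
        · exact fun y => hsurj s.1 (nonZeroDivisors.coe_ne_zero s) y
      surj := fun y => ⟨(y, 1), by simp⟩
      exists_of_eq := fun {x y} hxy => ⟨1, by simpa using hxy⟩ }
  have : IsLocalizedModule (nonZeroDivisors ℤ) (TensorProduct.mk ℤ ℚ G 1) :=
    (isLocalizedModule_iff_isBaseChange (nonZeroDivisors ℤ) ℚ _).mpr
      (TensorProduct.isBaseChange ℤ G ℚ)
  let l : G ≃+ TensorProduct ℤ ℚ G := (IsLocalizedModule.linearEquiv (nonZeroDivisors ℤ)
    (LinearMap.id : G →ₗ[ℤ] G) (TensorProduct.mk ℤ ℚ G 1)).toAddEquiv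
  exact ⟨(l.trans e.toAddEquiv).trans (AddEquiv.prodCongr l.symm l.symm)⟩

end Helpers

open DirectSum in
/-- A divisible group `D = D₀ ⊕ (⊕ₚ Dₚ)` (with `D₀` torsion-free and
`Dₚ` the `p`-primary components) is relatively Hopfian (equivalently weakly Hopfian,
equivalently directly finite) iff `D₀` has finite rank and each `Dₚ` has finite
`p`-rank. -/
theorem divisible_classes_iff_finite_ranks (D₀ : Type u) [AddCommGroup D₀]
    (h₀ : TorsionFreeGroup D₀) (Dp : Nat.Primes → Type u) [∀ p, AddCommGroup (Dp p)]
    (hDp : ∀ p : Nat.Primes, IsPAddGroup (Dp p) (p : ℕ))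
    (hdiv : DivisibleGroup (D₀ × ⨁ p : Nat.Primes, Dp p)) :
    (RelativelyHopfian (D₀ × ⨁ p : Nat.Primes, Dp p) ↔
        (rationalRank D₀ < Cardinal.aleph0 ∧
          ∀ p : Nat.Primes, pRank (Dp p) (p : ℕ) < Cardinal.aleph0)) ∧
    (WeaklyHopfian (D₀ × ⨁ p : Nat.Primes, Dp p) ↔
        (rationalRank D₀ < Cardinal.aleph0 ∧
          ∀ p : Nat.Primes, pRank (Dp p) (p : ℕ) < Cardinal.aleph0)) ∧
    (DirectlyFinite (D₀ × ⨁ p : Nat.Primes, Dp p) ↔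
        (rationalRank D₀ < Cardinal.aleph0 ∧
          ∀ p : Nat.Primes, pRank (Dp p) (p : ℕ) < Cardinal.aleph0)) := by
  classical
  have fin_RH : (rationalRank D₀ < Cardinal.aleph0 ∧
      ∀ p : Nat.Primes, pRank (Dp p) (p : ℕ) < Cardinal.aleph0) →
      RelativelyHopfian (D₀ × ⨁ p : Nat.Primes, Dp p) := by
    rintro ⟨hr, hp⟩
    apply aux_relHopf
    · have h0 : Module.rank ℤ (⨁ p : Nat.Primes, Dp p) = 0 := by
        rw [rank_eq_zero_iff]
        intro x
        induction x using DirectSum.induction_on with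
        | zero => exact ⟨1, one_ne_zero, smul_zero _⟩
        | of p y =>
          obtain ⟨n, hn⟩ := hDp p y
          refine ⟨((p : ℕ) ^ n : ℕ), ?_, ?_⟩
          · exact_mod_cast pow_ne_zero n p.2.ne_zero
          · rw [natCast_zsmul, ← map_nsmul, hn, map_zero]
        | add x y hx hy =>
          obtain ⟨a, ha, hx⟩ := hx
          obtain ⟨b, hb, hy⟩ := hy
          refine ⟨a * b, mul_ne_zero ha hb, ?_⟩
          rw [smul_add, mul_smul a b y, hy, smul_zero, mul_comm, mul_smul, hx, smul_zero, add_zero]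
      rw [aux_rank_prod, h0, add_zero, ← aux_rationalRank]
      exact hr
    · intro p' hpp
      obtain ⟨p, rfl⟩ : ∃ p : Nat.Primes, (p : ℕ) = p' := ⟨⟨p', hpp⟩, rfl⟩
      have := aux_pRank_finite p hpp (hp p)
      refine Finite.of_injective (β := torsionSub (Dp p) p)
        (fun x => ⟨x.1.2 p, ?_⟩) ?_
      · have hx : (p : ℕ) • x.1 = 0 := x.2
        have := congrArg (fun z : D₀ × ⨁ p : Nat.Primes, Dp p => z.2 p) hx
        exact this
      · intro x y hxy
        have hxy' : x.1.2 p = y.1.2 p := congrArg Subtype.val hxy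
        have key : ∀ z : torsionSub (D₀ × ⨁ p : Nat.Primes, Dp p) p,
            z.1.1 = 0 ∧ ∀ q : Nat.Primes, q ≠ p → z.1.2 q = 0 := by
          intro z
          have hz : (p : ℕ) • z.1 = 0 := z.2
          refine ⟨h₀ _ (p : ℕ) hpp.pos (congrArg Prod.fst hz), fun q hq => ?_⟩
          have h1 : (p : ℕ) • z.1.2 q = 0 :=
            congrArg (fun z : D₀ × ⨁ p : Nat.Primes, Dp p => z.2 q) hz
          obtain ⟨n, hn⟩ := hDp q (z.1.2 q)
          have hc : Nat.Coprime p ((q : ℕ) ^ n) := by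
            apply Nat.Coprime.pow_right
            rw [Nat.coprime_primes hpp q.2]
            intro h
            exact hq (Subtype.ext h.symm)
          have h2 := Nat.dvd_gcd (addOrderOf_dvd_of_nsmul_eq_zero h1)
            (addOrderOf_dvd_of_nsmul_eq_zero hn)
          rw [hc.gcd_eq_one, Nat.dvd_one, AddMonoid.addOrderOf_eq_one_iff] at h2
          exact h2
        apply Subtype.ext
        refine Prod.ext ?_ ?_
        · rw [(key x).1, (key y).1]
        · refine DFinsupp.ext fun q => ?_
          by_cases hq : q = p
          · subst hq; exact hxy'
          · exact ((key x).2 q hq).trans ((key y).2 q hq).symm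
  have hd0 : DivisibleGroup D₀ := by
    intro n hn x
    obtain ⟨y, hy⟩ := hdiv n hn (x, 0)
    exact ⟨y.1, congrArg Prod.fst hy⟩
  have hdp : ∀ p, DivisibleGroup (Dp p) := by
    intro p n hn x
    obtain ⟨y, hy⟩ := hdiv n hn (0, DirectSum.of Dp p x)
    refine ⟨y.2 p, ?_⟩
    have h1 : n • y.2 p = (DirectSum.of Dp p x) p :=
      congrArg (fun z : D₀ × ⨁ p : Nat.Primes, Dp p => z.2 p) hy
    rw [h1, DirectSum.of_eq_same]
  have DF_fin : DirectlyFinite (D₀ × ⨁ p : Nat.Primes, Dp p) →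
      (rationalRank D₀ < Cardinal.aleph0 ∧
      ∀ p : Nat.Primes, pRank (Dp p) (p : ℕ) < Cardinal.aleph0) := by
    intro h
    constructor
    · by_contra hc
      rw [not_lt] at hc
      obtain ⟨e⟩ := aux_q_self_prod h₀ hd0 hc
      have := aux_retract_s10 h (AddMonoidHom.inl _ _) (AddMonoidHom.fst _ _) (fun _ => rfl) e
      rw [aux_rationalRank, rank_subsingleton'] at hc
      exact absurd hc (not_le.mpr Cardinal.aleph0_pos)
    · intro p
      by_contra hc
      rw [not_lt] at hc
      obtain ⟨e⟩ := aux_p_self_prod p p.2 (hDp p) (hdp p) hc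
      have := aux_retract_s10 h
        ((AddMonoidHom.inr D₀ (⨁ p : Nat.Primes, Dp p)).comp (DirectSum.of Dp p))
        { toFun := fun z => z.2 p
          map_zero' := rfl
          map_add' := fun _ _ => rfl }
        (fun b => DirectSum.of_eq_same p b) e
      have : Fact (p : ℕ).Prime := ⟨p.2⟩
      unfold pRank at hc
      rw [rank_subsingleton'] at hc
      exact absurd hc (not_le.mpr Cardinal.aleph0_pos)
  refine ⟨⟨fun h => DF_fin (aux_DF_of_RH h), fin_RH⟩,
    ⟨fun h => DF_fin (aux_DF_of_WH h), fun h => aux_WH_of_DF hdiv (aux_DF_of_RH (fin_RH h))⟩,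
    ⟨DF_fin, fun h => aux_DF_of_RH (fin_RH h)⟩⟩
end

section
/- Let p be a prime and G a p-semi-standard abelian p-group. Let H be a subgroup of G such that the minimum of the p-heights in G of the elements of H equals a finite natural number m (i.e., H ⊆ p^m G and some element of H does not lie in p^{m+1}G). If G/H ≅ G, then m = 0. -/
open Function

universe u

theorem finite_of_rank_aux (p : ℕ) [Fact p.Prime] (M : Type u) [AddCommGroup M]
    [Module (ZMod p) M] (h : Module.rank (ZMod p) M < Cardinal.aleph0) : Finite M := by
  have : Module.Finite (ZMod p) M := Module.rank_lt_aleph0_iff.mp h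
  exact Module.finite_of_finite (ZMod p)

theorem finite_ulmQuot_aux (p : ℕ) (hp : p.Prime) (G : Type u) [AddCommGroup G]
    (hss : PSemiStandard G p) (n : ℕ) : Finite (UlmQuot G p n) := by
  have : Fact p.Prime := ⟨hp⟩
  exact @finite_of_rank_aux p _ (UlmQuot G p n) _
    (AddCommGroup.zmodModule (UlmQuot_nsmul G p n)) (hss n)

theorem min_height_aux (p : ℕ) (hp : p.Prime)
    (G : Type u) [AddCommGroup G] (hss : PSemiStandard G p)
    (φ : G →+ G) (hφ : Surjective φ) (n : ℕ)
    (hle : ∀ h, φ h = 0 → ∃ g, p ^ (n + 1) • g = h)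
    (h : G) (hh : φ h = 0) : ∃ g, p ^ (n + 1 + 1) • g = h := by
  have hmap : ∀ k, ∀ x ∈ ulmSub G p k, φ x ∈ ulmSub G p k := by
    rintro k x ⟨⟨g, hg⟩, hx⟩
    refine ⟨⟨φ g, ?_⟩, ?_⟩
    · change p ^ k • φ g = φ x
      rw [← map_nsmul]; exact congrArg φ hg
    · change p • φ x = 0
      rw [← map_nsmul, show p • x = 0 from hx, map_zero]
  let r : ↥(ulmSub G p n) →+ ↥(ulmSub G p n) :=
    (φ.comp (ulmSub G p n).subtype).codRestrict (ulmSub G p n) (fun x => hmap n x x.2)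
  let f : UlmQuot G p n →+ UlmQuot G p n :=
    QuotientAddGroup.map _ _ r (fun x hx => hmap (n + 1) x hx)
  have hinj : Injective f := by
    rw [injective_iff_map_eq_zero]
    intro a ha
    induction a using QuotientAddGroup.induction_on with
    | _ x =>
      have h1 : φ (x : G) ∈ ulmSub G p (n + 1) := by
        have : ((r x : ↥(ulmSub G p n)) : UlmQuot G p n) = 0 := ha
        exact (QuotientAddGroup.eq_zero_iff (r x)).mp this
      rw [QuotientAddGroup.eq_zero_iff]
      refine ⟨?_, x.2.2⟩
      obtain ⟨⟨w, hw⟩, -⟩ := h1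
      obtain ⟨z, rfl⟩ := hφ w
      have hw : p ^ (n + 1) • φ z = φ x := hw
      obtain ⟨g, hg⟩ := hle ((x : G) - p ^ (n + 1) • z) (by
        rw [map_sub, map_nsmul, hw, sub_self])
      refine ⟨g + z, ?_⟩
      change p ^ (n + 1) • (g + z) = (x : G)
      rw [smul_add, hg, sub_add_cancel]
  have := finite_ulmQuot_aux p hp G hss n
  have hsurj : Surjective f := Finite.surjective_of_injective hinj
  obtain ⟨g, hg⟩ := hle h hh
  have hy : φ (p ^ n • g) ∈ ulmSub G p n := by
    refine ⟨⟨φ g, (map_nsmul φ _ _).symm⟩, ?_⟩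
    change p • φ (p ^ n • g) = 0
    rw [← map_nsmul, smul_smul, ← pow_succ', hg, hh]
  obtain ⟨a, ha⟩ := hsurj ((⟨_, hy⟩ : ↥(ulmSub G p n)) : UlmQuot G p n)
  induction a using QuotientAddGroup.induction_on with
  | _ x =>
    have h1 : ((r x : ↥(ulmSub G p n)) : UlmQuot G p n) = ((⟨_, hy⟩ : ↥(ulmSub G p n)) : UlmQuot G p n) := ha
    obtain ⟨⟨w, hw⟩, -⟩ := QuotientAddGroup.eq.mp h1
    obtain ⟨z, rfl⟩ := hφ w
    have hw : p ^ (n + 1) • φ z = -φ x + φ (p ^ n • g) := hw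
    obtain ⟨t, ht⟩ := hle (-(x : G) + p ^ n • g - p ^ (n + 1) • z) (by
      rw [map_sub, map_add, map_neg, map_nsmul φ _ z, hw, sub_self])
    have hx : p • (x : G) = 0 := x.2.2
    refine ⟨t + z, ?_⟩
    rw [pow_succ' p (n + 1), mul_smul, smul_add, ht, sub_add_cancel, smul_add, smul_neg, hx,
      smul_smul, ← pow_succ', hg]
    simp

/-- In a `p`-semi-standard `p`-group `G`, if `H ≤ G` has minimal
`p`-height exactly `m < ω` and `G/H ≅ G`, then `m = 0`. -/
theorem min_height_eq_zero_of_semiStandard (p : ℕ) (hp : p.Prime)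
    (G : Type u) [AddCommGroup G] (hG : IsPAddGroup G p) (hss : PSemiStandard G p)
    (H : AddSubgroup G) (m : ℕ) (hle : H ≤ smulSub G (p ^ m))
    (hnot : ∃ h ∈ H, h ∉ smulSub G (p ^ (m + 1)))
    (hiso : Nonempty ((G ⧸ H) ≃+ G)) : m = 0 := by
  obtain ⟨e⟩ := hiso
  obtain ⟨h, hH, hn⟩ := hnot
  cases m with
  | zero => rfl
  | succ n =>
    exfalso
    apply hn
    have hker : ∀ x, e.toAddMonoidHom.comp (QuotientAddGroup.mk' H) x = 0 ↔ x ∈ H := by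
      intro x
      change e (x : G ⧸ H) = 0 ↔ x ∈ H
      rw [map_eq_zero_iff e e.injective, QuotientAddGroup.eq_zero_iff]
    exact min_height_aux p hp G hss (e.toAddMonoidHom.comp (QuotientAddGroup.mk' H))
      (e.surjective.comp (QuotientAddGroup.mk'_surjective H)) n
      (fun x hx => hle ((hker x).mp hx)) h ((hker h).mpr hH)
end
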